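/- arXiv:2305.04363 — 2 statements merged into one kernel-verified Lean document; each statement's English description precedes it below -/
import Mathlib

section
/- For every ε > 0 there exists a constant τ > 0 such that the following holds for all sufficiently large n and all k with 1 ≤ k ≤ n and n/k sufficiently large (in terms of ε): if X is a distribution on {0,1}^n sampled with decision depth d ≤ τ · log(n/k) / log log(n/k), then Δ(X, U_k^n) ≥ 1 − ε. -/
open Finset

/-- Hamming weight of a bit string. -/
def wt {n : ℕ} (x : Fin n → Bool) : ℕ := (Finset.univ.filter fun i => x i = true).card

/-- Binary decision trees querying input bits. -/
inductive DTree (m : ℕ) : Type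
  | leaf : Bool → DTree m
  | node : Fin m → DTree m → DTree m → DTree m

def DTree.eval {m : ℕ} : DTree m → (Fin m → Bool) → Bool
  | .leaf b, _ => b
  | .node i t0 t1, y => if y i then t1.eval y else t0.eval y

def DTree.depth {m : ℕ} : DTree m → ℕ
  | .leaf _ => 0
  | .node _ t0 t1 => max t0.depth t1.depth + 1

/-- `f` has decision depth `d`: every output bit is computed by a depth-`≤ d` decision tree. -/
def hasDecisionDepth {m n : ℕ} (f : (Fin m → Bool) → (Fin n → Bool)) (d : ℕ) : Prop :=
  ∀ j : Fin n, ∃ t : DTree m, t.depth ≤ d ∧ ∀ y, f y j = t.eval y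

/-- The mass function of the distribution `f(Y)` for `Y` uniform on `{0,1}^m`. -/
noncomputable def srcDist {m n : ℕ} (f : (Fin m → Bool) → (Fin n → Bool)) :
    (Fin n → Bool) → ℝ :=
  fun x => ((Finset.univ.filter fun y => f y = x).card : ℝ) / 2 ^ m

/-- The mass function of the uniform distribution on Hamming-weight-`k` strings. -/
noncomputable def uniformSlice (n k : ℕ) : (Fin n → Bool) → ℝ :=
  fun x => if wt x = k then 1 / (n.choose k : ℝ) else 0

/-- Statistical distance between two mass functions: `max_A |P(A) - Q(A)|`. -/
noncomputable def SD {α : Type*} [Fintype α] (P Q : α → ℝ) : ℝ :=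
  ⨆ A : Finset α, |∑ x ∈ A, P x - ∑ x ∈ A, Q x|


section helpers

variable {m : ℕ}

/-- number of functions satisfying a consistent term -/
lemma count_sat {X : Type*} [Fintype X] [DecidableEq X] (e : Bool → X)
    (P : Finset (Fin m × Bool)) (hP : ∃ y : Fin m → Bool, ∀ p ∈ P, y p.1 = p.2) :
    (univ.filter fun w : Fin m → X => ∀ p ∈ P, w p.1 = e p.2).card * (Fintype.card X) ^ P.card
      = (Fintype.card X) ^ m := by
  obtain ⟨y, hy⟩ := hP
  have h1 : (univ.filter fun w : Fin m → X => ∀ p ∈ P, w p.1 = e p.2)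
      = Fintype.piFinset (fun v : Fin m => if v ∈ P.image Prod.fst then {e (y v)} else univ) := by
    ext w
    simp only [mem_filter, mem_univ, true_and, Fintype.mem_piFinset]
    constructor
    · intro h v
      split_ifs with hv
      · obtain ⟨p, hp, rfl⟩ := mem_image.1 hv
        rw [mem_singleton, h p hp, hy p hp]
      · exact mem_univ _
    · intro h p hp
      have := h p.1
      rw [if_pos (mem_image_of_mem _ hp), mem_singleton, hy p hp] at this
      exact this
  have h2 : (P.image Prod.fst).card = P.card := by
    apply card_image_of_injOn
    intro p hp p' hp' h
    refine Prod.ext h ?_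
    rw [← hy p hp, ← hy p' hp']
    exact congrArg y h
  rw [h1, Fintype.card_piFinset, ← h2]
  have h3 : ∀ v : Fin m, (if v ∈ P.image Prod.fst then {e (y v)} else (univ : Finset X)).card
      = if v ∈ P.image Prod.fst then 1 else Fintype.card X := by
    intro v; split_ifs <;> simp
  simp_rw [h3]
  rw [prod_ite, prod_const_one, one_mul, prod_const, ← pow_add]
  congr 1
  have := card_filter_add_card_filter_not (s := (univ : Finset (Fin m)))
    (fun v => v ∈ P.image Prod.fst)
  rw [filter_univ_mem, card_univ, Fintype.card_fin] at this
  rw [add_comm]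
  exact this

lemma count_sat_le {X : Type*} [Fintype X] [DecidableEq X] (e : Bool → X)
    (he : Function.Injective e) (P P' : Finset (Fin m × Bool)) :
    (univ.filter fun w : Fin m → X => (∀ p ∈ P, w p.1 = e p.2) ∧ ∀ p ∈ P', w p.1 = e p.2).card
      * (Fintype.card X) ^ (P ∪ P').card ≤ (Fintype.card X) ^ m := by
  by_cases h : ∃ w : Fin m → X, (∀ p ∈ P, w p.1 = e p.2) ∧ ∀ p ∈ P', w p.1 = e p.2
  · obtain ⟨w, hw, hw'⟩ := h
    rw [← count_sat e (P ∪ P')]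
    · gcongr with w'
      rintro ⟨h1, h2⟩ p hp
      rcases mem_union.1 hp with hp | hp
      · exact h1 p hp
      · exact h2 p hp
    · classical
      refine ⟨fun v => Function.invFun e (w v), fun p hp => ?_⟩
      have : w p.1 = e p.2 := by
        rcases mem_union.1 hp with hp | hp
        · exact hw p hp
        · exact hw' p hp
      show Function.invFun e (w p.1) = p.2
      rw [this]
      exact Function.leftInverse_invFun he _
  · push Not at h
    rw [filter_false_of_mem]
    · simp
    · intro w _ ⟨h1, h2⟩
      obtain ⟨p, hp, hne⟩ := h w h1
      exact hne (h2 p hp)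

lemma pow_bound (d : ℕ) : (1 + 1 / (32 * ((d : ℝ) + 1))) ^ d ≤ 32 / 31 := by
  have h1 : (1 + 1 / (32 * ((d : ℝ) + 1))) ≤ Real.exp (1 / (32 * ((d : ℝ) + 1))) := by
    linarith [Real.add_one_le_exp (1 / (32 * ((d : ℝ) + 1)))]
  have h2 : (1 + 1 / (32 * ((d : ℝ) + 1))) ^ d ≤ Real.exp (d * (1 / (32 * ((d : ℝ) + 1)))) := by
    rw [Real.exp_nat_mul]
    gcongr
  refine h2.trans ?_
  have h3 : (d : ℝ) * (1 / (32 * ((d : ℝ) + 1))) ≤ 1 / 32 := by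
    rw [mul_one_div, div_le_div_iff₀ (by positivity) (by norm_num)]
    linarith
  refine (Real.exp_le_exp.2 h3).trans ?_
  have h4 := Real.add_one_le_exp (-(1 / 32 : ℝ))
  rw [Real.exp_neg] at h4
  have h5 := Real.exp_pos (1 / 32 : ℝ)
  rw [le_div_iff₀ (by norm_num)]
  have h6 : (31 / 32 : ℝ) ≤ (Real.exp (1 / 32))⁻¹ := by linarith
  have h7 := mul_le_mul_of_nonneg_left h6 h5.le
  rw [mul_inv_cancel₀ h5.ne'] at h7
  linarith

/-- second moment method -/
lemma moment {ι X : Type*} [DecidableEq ι] [Fintype X] [DecidableEq X] (e : Bool → X)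
    (he : Function.Injective e) (hX : 0 < Fintype.card X)
    (G : Finset ι) (P : ι → Finset (Fin m × Bool)) (d k : ℕ)
    (hsat : ∀ i ∈ G, ∃ y : Fin m → Bool, ∀ p ∈ P i, y p.1 = p.2)
    (hd : ∀ i ∈ G, (P i).card ≤ d)
    (hspread : ∀ S : Finset (Fin m × Bool), (G.filter fun i => S ⊆ P i).card *
      (32 * Fintype.card X * (d + 1)) ^ S.card ≤ G.card)
    (hbig : 2 * k * (Fintype.card X) ^ d < G.card) :
    (univ.filter fun w : Fin m → X =>
      (G.filter fun i => ∀ p ∈ P i, w p.1 = e p.2).card ≤ k).card * 4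
      ≤ (Fintype.card X) ^ m := by
  classical
  set a : ℕ := Fintype.card X with ha
  set N : ℝ := (G.card : ℝ) with hN
  have haR : (0 : ℝ) < a := by exact_mod_cast hX
  have ha1 : (1 : ℝ) ≤ a := by exact_mod_cast hX
  have hNpos : 0 < N := by
    have : 0 < G.card := by omega
    rw [hN]
    exact_mod_cast this
  let Z : (Fin m → X) → ℝ := fun w =>
    ∑ i ∈ G, if (∀ p ∈ P i, w p.1 = e p.2) then (a : ℝ) ^ (P i).card else 0
  have hZ1 : ∑ w, Z w = N * a ^ m := by
    simp only [Z]
    rw [sum_comm]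
    have : ∀ i ∈ G, (∑ w : Fin m → X, if (∀ p ∈ P i, w p.1 = e p.2) then (a : ℝ) ^ (P i).card
        else 0) = a ^ m := by
      intro i hi
      rw [← sum_filter, sum_const, nsmul_eq_mul]
      exact_mod_cast count_sat e (P i) (hsat i hi)
    rw [sum_congr rfl this, sum_const, nsmul_eq_mul]
  have hinner : ∀ i ∈ G, ∑ j ∈ G, (a : ℝ) ^ (P i ∩ P j).card ≤ N * (32 / 31) := by
    intro i hi
    calc ∑ j ∈ G, (a : ℝ) ^ (P i ∩ P j).card
        ≤ ∑ j ∈ G, ∑ S ∈ (P i ∩ P j).powerset, (a : ℝ) ^ S.card := by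
          gcongr with j hj
          have := Finset.sum_pow_mul_eq_add_pow (a : ℝ) 1 (P i ∩ P j)
          simp only [one_pow, mul_one] at this
          rw [this]
          gcongr
          linarith
      _ = ∑ j ∈ G, ∑ S ∈ (P i).powerset, if S ⊆ P j then (a : ℝ) ^ S.card else 0 := by
          refine sum_congr rfl fun j _ => ?_
          rw [← sum_filter]
          refine sum_congr ?_ fun _ _ => rfl
          ext S
          rw [mem_powerset, mem_filter, mem_powerset, subset_inter_iff]
      _ = ∑ S ∈ (P i).powerset, ((G.filter fun j => S ⊆ P j).card : ℝ) * (a : ℝ) ^ S.card := by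
          rw [sum_comm]
          refine sum_congr rfl fun S _ => ?_
          rw [← sum_filter, sum_const, nsmul_eq_mul]
      _ ≤ ∑ S ∈ (P i).powerset, N * (1 / (32 * ((d : ℝ) + 1))) ^ S.card := by
          refine sum_le_sum fun S hS => ?_
          have h := hspread S
          have h' : ((G.filter fun j => S ⊆ P j).card : ℝ) * (32 * a * (d + 1)) ^ S.card ≤ N := by
            rw [hN]
            exact_mod_cast h
          rw [one_div, inv_pow, ← div_eq_mul_inv, le_div_iff₀ (by positivity), mul_assoc,
            ← mul_pow]
          have h3 : (a : ℝ) * (32 * ((d : ℝ) + 1)) = 32 * a * (d + 1) := by ring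
          rw [h3]
          exact h'
      _ = N * (1 + 1 / (32 * ((d : ℝ) + 1))) ^ (P i).card := by
          rw [← mul_sum]
          have := Finset.sum_pow_mul_eq_add_pow (1 / (32 * ((d : ℝ) + 1))) 1 (P i)
          simp only [one_pow, mul_one] at this
          rw [this, add_comm]
      _ ≤ N * (1 + 1 / (32 * ((d : ℝ) + 1))) ^ d := by
          gcongr
          · linarith [show (0 : ℝ) ≤ 1 / (32 * ((d : ℝ) + 1)) by positivity]
          · exact hd i hi
      _ ≤ N * (32 / 31) := by
          gcongr
          exact pow_bound d
  have hZ2 : ∑ w, (Z w) ^ 2 ≤ N ^ 2 * (32 / 31) * a ^ m := by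
    calc ∑ w, (Z w) ^ 2 = ∑ w : Fin m → X, ∑ i ∈ G, ∑ j ∈ G,
          (if ((∀ p ∈ P i, w p.1 = e p.2) ∧ (∀ p ∈ P j, w p.1 = e p.2)) then
            (a : ℝ) ^ (P i).card * (a : ℝ) ^ (P j).card else 0) := by
          refine sum_congr rfl fun w _ => ?_
          simp only [Z]
          rw [sq, sum_mul_sum]
          refine sum_congr rfl fun i _ => sum_congr rfl fun j _ => ?_
          rw [ite_zero_mul_ite_zero]
      _ = ∑ i ∈ G, ∑ j ∈ G, ∑ w : Fin m → X,
          (if ((∀ p ∈ P i, w p.1 = e p.2) ∧ (∀ p ∈ P j, w p.1 = e p.2)) then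
            (a : ℝ) ^ (P i).card * (a : ℝ) ^ (P j).card else 0) := by
          rw [sum_comm]
          refine sum_congr rfl fun i _ => ?_
          rw [sum_comm]
      _ ≤ ∑ i ∈ G, ∑ j ∈ G, (a : ℝ) ^ (P i ∩ P j).card * a ^ m := by
          gcongr with i hi j hj
          rw [← sum_filter, sum_const, nsmul_eq_mul, ← pow_add, ← card_union_add_card_inter,
            pow_add]
          have := count_sat_le e he (P i) (P j)
          have h' : ((univ.filter fun w : Fin m → X => (∀ p ∈ P i, w p.1 = e p.2) ∧
            ∀ p ∈ P j, w p.1 = e p.2).card : ℝ) * a ^ (P i ∪ P j).card ≤ a ^ m := by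
            exact_mod_cast this
          rw [← mul_assoc, mul_comm _ ((a : ℝ) ^ m)]
          gcongr
      _ = (∑ i ∈ G, ∑ j ∈ G, (a : ℝ) ^ (P i ∩ P j).card) * a ^ m := by
          rw [sum_mul]
          refine sum_congr rfl fun i _ => ?_
          rw [sum_mul]
      _ ≤ (∑ i ∈ G, N * (32 / 31)) * a ^ m := by
          gcongr with i hi
          exact hinner i hi
      _ = N ^ 2 * (32 / 31) * a ^ m := by
          rw [sum_const, nsmul_eq_mul]; ring
  have hvar : ∑ w, (Z w - N) ^ 2 ≤ N ^ 2 / 31 * a ^ m := by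
    have : ∑ w, (Z w - N) ^ 2 = ∑ w, (Z w) ^ 2 - 2 * N * ∑ w, Z w + N ^ 2 * a ^ m := by
      have h0 : ∑ w : Fin m → X, N ^ 2 = N ^ 2 * a ^ m := by
        simp [ha]; ring
      rw [← h0, mul_sum, ← sum_sub_distrib, ← sum_add_distrib]
      refine sum_congr rfl fun w _ => ?_
      ring
    rw [this, hZ1]
    nlinarith
  set B := (univ.filter fun w : Fin m → X =>
      (G.filter fun i => ∀ p ∈ P i, w p.1 = e p.2).card ≤ k) with hB
  have hbad : (B.card : ℝ) * (N ^ 2 / 4) ≤ ∑ w, (Z w - N) ^ 2 := by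
    calc (B.card : ℝ) * (N ^ 2 / 4) = ∑ w ∈ B, N ^ 2 / 4 := by
          rw [sum_const, nsmul_eq_mul]
      _ ≤ ∑ w ∈ B, (Z w - N) ^ 2 := by
          gcongr with w hw
          have hw' : (G.filter fun i => ∀ p ∈ P i, w p.1 = e p.2).card ≤ k := (mem_filter.1 hw).2
          have hZle : Z w ≤ k * a ^ d := by
            simp only [Z]
            rw [← sum_filter]
            calc _ ≤ ∑ i ∈ G.filter (fun i => ∀ p ∈ P i, w p.1 = e p.2), (a : ℝ) ^ d := by
                  gcongr with i hi
                  exact hd i (mem_filter.1 hi).1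
              _ ≤ k * a ^ d := by
                  rw [sum_const, nsmul_eq_mul]
                  gcongr
          have hb : 2 * (k : ℝ) * a ^ d < N := by
            rw [hN]
            exact_mod_cast hbig
          have : N / 2 ≤ N - Z w := by linarith
          nlinarith
      _ ≤ ∑ w, (Z w - N) ^ 2 :=
          sum_le_sum_of_subset_of_nonneg (subset_univ _) fun _ _ _ => sq_nonneg _
  have hfin : (B.card : ℝ) * 4 ≤ a ^ m := by
    have h1 := hbad.trans hvar
    have hpos : (0 : ℝ) < a ^ m := by positivity
    have hN2 : 0 < N ^ 2 := by positivity
    have h2 : (B.card : ℝ) / 4 ≤ a ^ m / 31 := by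
      refine le_of_mul_le_mul_left ?_ hN2
      linarith
    linarith
  exact_mod_cast hfin

end helpers

section helpers2

/-- independence of events depending on disjoint blocks of coordinates -/
lemma indep_blocks {m q : ℕ} (c : Fin m → Fin q) (E : Fin q → Finset (Fin m → Bool))
    (hE : ∀ t y y', (∀ v, c v = t → y v = y' v) → y ∈ E t → y' ∈ E t) :
    (univ.filter fun y : Fin m → Bool => ∀ t, y ∈ E t).card * (2 ^ m) ^ q
      = 2 ^ m * ∏ t, (E t).card := by
  classical
  let glue : (Fin q → Fin m → Bool) → (Fin m → Bool) := fun Y v => Y (c v) v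
  have h1 : (univ.filter fun Y : Fin q → Fin m → Bool => ∀ t, glue Y ∈ E t).card
      = ∏ t, (E t).card := by
    rw [← Fintype.card_piFinset]
    congr 1
    ext Y
    simp only [mem_filter, mem_univ, true_and, Fintype.mem_piFinset]
    refine forall_congr' fun t => ⟨hE t _ _ ?_, hE t _ _ ?_⟩
    · intro v hv; simp [glue, hv]
    · intro v hv; simp [glue, hv]
  have h2 : ∀ y : Fin m → Bool,
      (univ.filter fun Y : Fin q → Fin m → Bool => ∀ t, glue Y ∈ E t).card
      = (univ.filter fun Y : Fin q → Fin m → Bool =>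
          ∀ t, (fun v => xor (glue Y v) (y v)) ∈ E t).card := by
    intro y
    refine card_bij' (fun Y _ => fun t v => xor (Y t v) (y v))
      (fun Y _ => fun t v => xor (Y t v) (y v)) ?_ ?_ ?_ ?_
    · intro Y hY
      simp only [mem_filter, mem_univ, true_and] at hY ⊢
      simpa [glue] using hY
    · intro Y hY
      simp only [mem_filter, mem_univ, true_and] at hY ⊢
      simpa [glue] using hY
    · intro Y _
      funext t v
      simp
    · intro Y _
      funext t v
      simp
  have h3 : ∀ g : Fin m → Bool,
      (univ.filter fun y : Fin m → Bool => ∀ t, y ∈ E t).card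
      = (univ.filter fun y : Fin m → Bool => ∀ t, (fun v => xor (g v) (y v)) ∈ E t).card := by
    intro g
    refine card_bij' (fun y _ => fun v => xor (g v) (y v))
      (fun y _ => fun v => xor (g v) (y v)) ?_ ?_ ?_ ?_
    · intro Y hY
      simp only [mem_filter, mem_univ, true_and] at hY ⊢
      simpa using hY
    · intro Y hY
      simp only [mem_filter, mem_univ, true_and] at hY ⊢
      simpa using hY
    · intro Y _
      funext v
      simp
    · intro Y _
      funext v
      simp
  have h4 : ∑ y : Fin m → Bool, (univ.filter fun Y : Fin q → Fin m → Bool =>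
          ∀ t, (fun v => xor (glue Y v) (y v)) ∈ E t).card
      = ∑ Y : Fin q → Fin m → Bool, (univ.filter fun y : Fin m → Bool =>
          ∀ t, (fun v => xor (glue Y v) (y v)) ∈ E t).card := by
    simp_rw [card_filter]
    rw [sum_comm]
  rw [sum_congr rfl fun y _ => (h2 y).symm, sum_congr rfl fun Y _ => (h3 (glue Y)).symm,
    sum_const, sum_const, h1] at h4
  simp at h4
  rw [h4]
  ring

lemma coloring {m q : ℕ} (hq : 0 < q) (fail : Fin q → (Fin m → Fin q × Bool) → Prop)
    (hloc : ∀ t (c : Fin m → Fin q) (y y' : Fin m → Bool), (∀ v, c v = t → y v = y' v) →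
      fail t (fun v => (c v, y v)) → fail t (fun v => (c v, y' v)))
    [∀ t, DecidablePred (fail t)]
    (hf : ∀ t, (univ.filter fun w => fail t w).card * 4 ≤ (2 * q) ^ m) :
    ∃ c : Fin m → Fin q,
      (univ.filter fun y : Fin m → Bool => ∀ t, fail t (fun v => (c v, y v))).card * 4 ^ q
        ≤ 2 ^ m := by
  classical
  have hne : (univ : Finset (Fin m → Fin q)).Nonempty := ⟨fun _ => ⟨0, hq⟩, mem_univ _⟩
  have key : ∃ c ∈ (univ : Finset (Fin m → Fin q)),
      ∑ t, (univ.filter fun y : Fin m → Bool => fail t (fun v => (c v, y v))).card * 4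
        ≤ q * 2 ^ m := by
    apply exists_le_of_sum_le hne
    rw [sum_comm]
    have h1 : ∀ t, ∑ c : Fin m → Fin q,
        (univ.filter fun y : Fin m → Bool => fail t (fun v => (c v, y v))).card * 4
        = (univ.filter fun w => fail t w).card * 4 := by
      intro t
      rw [← sum_mul]
      congr 1
      simp_rw [card_filter]
      rw [← Fintype.sum_prod_type'
        (f := fun (c : Fin m → Fin q) (y : Fin m → Bool) =>
          if fail t (fun v => (c v, y v)) then 1 else 0)]
      exact Fintype.sum_equiv (Equiv.arrowProdEquivProdArrow (Fin m) (fun _ => Fin q)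
        (fun _ => Bool)).symm _ _ (fun x => rfl)
    rw [sum_congr rfl fun t _ => h1 t]
    calc _ ≤ ∑ t : Fin q, (2 * q) ^ m := sum_le_sum fun t _ => hf t
      _ = ∑ c : Fin m → Fin q, q * 2 ^ m := by
        simp [mul_pow]; ring
  obtain ⟨c, -, hc⟩ := key
  refine ⟨c, ?_⟩
  let E : Fin q → Finset (Fin m → Bool) := fun t =>
    univ.filter fun y : Fin m → Bool => fail t (fun v => (c v, y v))
  have hi := indep_blocks c E (by
    intro t y y' h hy
    simp only [E, mem_filter, mem_univ, true_and] at hy ⊢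
    exact hloc t c y y' h hy)
  have hA : (univ.filter fun y : Fin m → Bool => ∀ t, fail t (fun v => (c v, y v)))
      = (univ.filter fun y : Fin m → Bool => ∀ t, y ∈ E t) := by
    ext y; simp [E]
  rw [hA]
  have hprod : (∏ t, ((E t).card : ℝ)) * 4 ^ q ≤ (2 ^ m) ^ q := by
    have h2 : ∀ t, ((E t).card : ℝ) * 4 / 2 ^ m ≤ Real.exp ((E t).card * 4 / 2 ^ m - 1) := by
      intro t
      linarith [Real.add_one_le_exp (((E t).card : ℝ) * 4 / 2 ^ m - 1)]
    have h3 : ∏ t, ((E t).card : ℝ) * 4 / 2 ^ m ≤ 1 := by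
      calc ∏ t, ((E t).card : ℝ) * 4 / 2 ^ m
          ≤ ∏ t, Real.exp ((E t).card * 4 / 2 ^ m - 1) :=
            prod_le_prod (fun t _ => by positivity) fun t _ => h2 t
        _ = Real.exp (∑ t, (((E t).card : ℝ) * 4 / 2 ^ m - 1)) := (Real.exp_sum _ _).symm
        _ ≤ 1 := by
          rw [Real.exp_le_one_iff, sum_sub_distrib, ← sum_div]
          have h4 : (∑ t, ((E t).card : ℝ) * 4) ≤ q * 2 ^ m := by exact_mod_cast hc
          have : (∑ t, ((E t).card : ℝ) * 4) / 2 ^ m ≤ q := by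
            rw [div_le_iff₀ (by positivity)]
            exact h4
          simpa using this
    rw [prod_div_distrib, prod_mul_distrib] at h3
    simp only [prod_const, card_univ, Fintype.card_fin] at h3
    rw [div_le_one (by positivity)] at h3
    exact h3
  have hprodN : (∏ t, (E t).card) * 4 ^ q ≤ (2 ^ m) ^ q := by exact_mod_cast hprod
  have hpos : 0 < (2 ^ m) ^ q := by positivity
  refine le_of_mul_le_mul_right ?_ hpos
  calc _ = (#{y | ∀ t, y ∈ E t} * (2 ^ m) ^ q) * 4 ^ q := by ring
    _ = 2 ^ m * ((∏ t, (E t).card) * 4 ^ q) := by rw [hi]; ring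
    _ ≤ 2 ^ m * (2 ^ m) ^ q := by gcongr

/-- greedy covering by cores -/
lemma covering {ι τ : Type*} [DecidableEq ι] [DecidableEq τ] (H : Finset τ → Prop)
    (s M : ℝ) (hs : 0 < s) (F : Finset (ι × Finset τ))
    (hcore : ∀ (I : Finset ι) (L : ι → Finset τ), M < I.card → (∀ i ∈ I, (i, L i) ∈ F) →
      ∃ T, H T ∧ s ≤ (I.filter fun i => T ⊆ L i).card) :
    ∃ C : Finset (Finset τ), (∀ T ∈ C, H T) ∧ (C.card : ℝ) * s ≤ F.card ∧
      (((F.filter fun x => ∀ T ∈ C, ¬ T ⊆ x.2).image Prod.fst).card : ℝ) ≤ M := by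
  classical
  induction hn : F.card using Nat.strong_induction_on generalizing F with
  | _ N ih =>
  subst hn
  by_cases hM : ((F.image Prod.fst).card : ℝ) ≤ M
  · exact ⟨∅, by simp, by simp, by simpa using hM⟩
  push Not at hM
  have hch : ∀ i : ι, ∃ L : Finset τ, i ∈ F.image Prod.fst → (i, L) ∈ F := by
    intro i
    by_cases hi : i ∈ F.image Prod.fst
    · obtain ⟨⟨j, L⟩, hx, rfl⟩ := mem_image.1 hi
      exact ⟨L, fun _ => hx⟩
    · exact ⟨∅, fun h => absurd h hi⟩
  choose L hL using hch
  obtain ⟨T, hT, hTs⟩ := hcore _ L hM hL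
  set F' := F.filter fun x => ¬ T ⊆ x.2 with hF'
  have hsub : (((F.image Prod.fst).filter fun i => T ⊆ L i).card) ≤
      (F.filter fun x => T ⊆ x.2).card := by
    apply card_le_card_of_injOn (fun i => (i, L i))
    · intro i hi
      have hi' := mem_filter.1 hi
      exact mem_filter.2 ⟨hL i hi'.1, hi'.2⟩
    · intro i _ j _ h
      exact (Prod.ext_iff.1 h).1
  have hcard := card_filter_add_card_filter_not (s := F) (fun x => T ⊆ x.2)
  have hsubR : s ≤ ((F.filter fun x => T ⊆ x.2).card : ℝ) :=
    hTs.trans (by exact_mod_cast hsub)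
  have hcardR : ((F.filter fun x => T ⊆ x.2).card : ℝ) + F'.card = F.card := by
    exact_mod_cast hcard
  have hlt : F'.card < F.card := by
    have : (F'.card : ℝ) < F.card := by linarith
    exact_mod_cast this
  obtain ⟨C, hC1, hC2, hC3⟩ := ih _ hlt F' (fun I L' h1 h2 =>
    hcore I L' h1 fun i hi => (mem_filter.1 (h2 i hi)).1) rfl
  refine ⟨insert T C, ?_, ?_, ?_⟩
  · intro T' h
    rcases mem_insert.1 h with rfl | h
    · exact hT
    · exact hC1 _ h
  · have : ((insert T C).card : ℝ) ≤ C.card + 1 := by exact_mod_cast card_insert_le _ _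
    nlinarith
  · refine le_trans ?_ hC3
    have : (F.filter fun x => ∀ T' ∈ insert T C, ¬ T' ⊆ x.2) =
        (F'.filter fun x => ∀ T ∈ C, ¬ T ⊆ x.2) := by
      ext x
      simp [hF', and_assoc]
    rw [this]

/-- choosing a core -/
lemma spread {ι τ : Type*} [Fintype τ] [DecidableEq τ] (I : Finset ι) (hI : I.Nonempty)
    (L : ι → Finset τ) (d κ : ℕ) (hκ : 0 < κ) (hd : ∀ i ∈ I, (L i).card ≤ d) :
    ∃ T : Finset τ, I.card ≤ κ ^ d * (I.filter fun i => T ⊆ L i).card ∧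
      ∀ S : Finset τ,
        ((I.filter fun i => T ⊆ L i).filter fun i => S ⊆ L i \ T).card * κ ^ S.card
          ≤ (I.filter fun i => T ⊆ L i).card := by
  classical
  obtain ⟨T, -, hT⟩ := exists_max_image (univ : Finset (Finset τ))
    (fun T => (I.filter fun i => T ⊆ L i).card * κ ^ T.card) ⟨∅, mem_univ _⟩
  have h0 := hT ∅ (mem_univ _)
  simp only [empty_subset, filter_true, card_empty, pow_zero, mul_one] at h0
  have hTd : T.card ≤ d := by
    have : 0 < (I.filter fun i => T ⊆ L i).card := by
      by_contra h
      have h' : (I.filter fun i => T ⊆ L i).card = 0 := by omega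
      rw [h'] at h0
      have := hI.card_pos
      omega
    obtain ⟨i, hi⟩ := card_pos.1 this
    have hi' := mem_filter.1 hi
    exact (card_le_card hi'.2).trans (hd i hi'.1)
  refine ⟨T, ?_, fun S => ?_⟩
  · refine h0.trans ?_
    rw [mul_comm]
    gcongr
  · by_cases hS : Disjoint S T
    · have h1 := hT (T ∪ S) (mem_univ _)
      rw [card_union_of_disjoint hS.symm, pow_add] at h1
      have h2 : ((I.filter fun i => T ⊆ L i).filter fun i => S ⊆ L i \ T).card ≤
          (I.filter fun i => T ∪ S ⊆ L i).card := by
        apply card_le_card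
        intro i hi
        simp only [mem_filter] at hi ⊢
        exact ⟨hi.1.1, union_subset hi.1.2 (hi.2.trans sdiff_subset)⟩
      have hpos : 0 < κ ^ T.card := by positivity
      refine le_of_mul_le_mul_right ?_ hpos
      calc _ ≤ (I.filter fun i => T ∪ S ⊆ L i).card * κ ^ S.card * κ ^ T.card := by gcongr
        _ = (I.filter fun i => T ∪ S ⊆ L i).card * (κ ^ T.card * κ ^ S.card) := by ring
        _ ≤ _ := h1
    · rw [filter_false_of_mem]
      · simp
      · intro i _ h
        exact hS (disjoint_of_subset_left h sdiff_disjoint)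

end helpers2

section main

/-- a large family of terms has a core which forces many satisfied terms -/
lemma core {m : ℕ} {ι : Type*} [DecidableEq ι] (I : Finset ι) (L : ι → Finset (Fin m × Bool))
    (d q k : ℕ) (hq : 0 < q)
    (hsat : ∀ i ∈ I, ∃ y : Fin m → Bool, ∀ p ∈ L i, y p.1 = p.2)
    (hd : ∀ i ∈ I, (L i).card ≤ d)
    (hbig : 2 * k * ((2 * q) * (32 * (2 * q) * (d + 1))) ^ d < I.card) :
    ∃ T : Finset (Fin m × Bool),
      I.card ≤ (32 * (2 * q) * (d + 1)) ^ d * (I.filter fun i => T ⊆ L i).card ∧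
      (univ.filter fun y : Fin m → Bool => (∀ p ∈ T, y p.1 = p.2) ∧
        (I.filter fun i => ∀ p ∈ L i, y p.1 = p.2).card ≤ k).card * 4 ^ q ≤ 2 ^ m := by
  classical
  set κ := 32 * (2 * q) * (d + 1) with hκ
  have hκpos : 0 < κ := by positivity
  have hI : I.Nonempty := card_pos.1 (by omega)
  obtain ⟨T, hT1, hT2⟩ := spread I hI L d κ hκpos hd
  refine ⟨T, hT1, ?_⟩
  set G := I.filter fun i => T ⊆ L i with hG
  have hcX : Fintype.card (Fin q × Bool) = 2 * q := by simp [mul_comm]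
  let fail : Fin q → (Fin m → Fin q × Bool) → Prop := fun t w =>
    (G.filter fun i => ∀ p ∈ L i \ T, w p.1 = (t, p.2)).card ≤ k
  obtain ⟨c, hc⟩ := coloring hq fail (by
      intro t c y y' h hf
      simp only [fail] at hf ⊢
      refine le_trans (card_le_card ?_) hf
      intro i hi
      simp only [mem_filter] at hi ⊢
      refine ⟨hi.1, fun p hp => ?_⟩
      have h1 := hi.2 p hp
      have h2 : c p.1 = t := (Prod.ext_iff.1 h1).1
      rw [← h1, h p.1 h2]) (by
      intro t
      have := moment (m := m) (X := Fin q × Bool) (fun b => (t, b))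
        (fun b b' h => (Prod.ext_iff.1 h).2) (by rw [hcX]; omega) G (fun i => L i \ T) d k
        (by
          intro i hi
          obtain ⟨y, hy⟩ := hsat i (mem_filter.1 hi).1
          exact ⟨y, fun p hp => hy p (sdiff_subset hp)⟩)
        (fun i hi => (card_le_card sdiff_subset).trans (hd i (mem_filter.1 hi).1))
        (by
          intro S
          rw [hcX]
          exact hT2 S)
        (by
          rw [hcX]
          have hpos : 0 < κ ^ d := by positivity
          refine lt_of_mul_lt_mul_left ?_ hpos.le
          refine lt_of_lt_of_le ?_ hT1
          have h5 : κ ^ d * (2 * k * (2 * q) ^ d) = 2 * k * ((2 * q) * κ) ^ d := by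
            rw [mul_pow (2 * q) κ]
            generalize (2 * q) ^ d = u
            generalize κ ^ d = v
            ring
          rw [h5]
          exact hbig)
      rw [hcX] at this
      exact this)
  refine le_trans ?_ hc
  gcongr with y
  rintro ⟨hy1, hy2⟩ t
  refine le_trans (card_le_card ?_) hy2
  intro i hi
  simp only [hG, mem_filter] at hi ⊢
  refine ⟨hi.1.1, fun p hp => ?_⟩
  by_cases hpT : p ∈ T
  · exact hy1 p hpT
  · exact (Prod.ext_iff.1 (hi.2 p (mem_sdiff.2 ⟨hp, hpT⟩))).2

/-- the terms of the accepting paths -/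
def DTree.terms {m : ℕ} : DTree m → Finset (Finset (Fin m × Bool))
  | .leaf b => if b then {∅} else ∅
  | .node i t0 t1 => (t0.terms.image (insert (i, false))) ∪ (t1.terms.image (insert (i, true)))

lemma DTree.card_terms {m : ℕ} (t : DTree m) : t.terms.card ≤ 2 ^ t.depth := by
  induction t with
  | leaf b => cases b <;> simp [DTree.terms, DTree.depth]
  | node i t0 t1 h0 h1 =>
    simp only [DTree.terms, DTree.depth]
    refine (card_union_le _ _).trans ?_
    have a0 : (t0.terms.image (insert (i, false))).card ≤ 2 ^ max t0.depth t1.depth :=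
      card_image_le.trans (h0.trans (Nat.pow_le_pow_right (by norm_num) (le_max_left _ _)))
    have a1 : (t1.terms.image (insert (i, true))).card ≤ 2 ^ max t0.depth t1.depth :=
      card_image_le.trans (h1.trans (Nat.pow_le_pow_right (by norm_num) (le_max_right _ _)))
    rw [pow_succ]
    omega

lemma DTree.terms_card_le {m : ℕ} (t : DTree m) : ∀ L ∈ t.terms, L.card ≤ t.depth := by
  induction t with
  | leaf b => cases b <;> simp [DTree.terms, DTree.depth]
  | node i t0 t1 h0 h1 =>
    intro L hL
    simp only [DTree.terms, DTree.depth] at hL ⊢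
    rcases mem_union.1 hL with h | h
    · obtain ⟨L', hL', rfl⟩ := mem_image.1 h
      have := h0 L' hL'
      have h2 := card_insert_le (i, false) L'
      have h3 := le_max_left t0.depth t1.depth
      omega
    · obtain ⟨L', hL', rfl⟩ := mem_image.1 h
      have := h1 L' hL'
      have h2 := card_insert_le (i, true) L'
      have h3 := le_max_right t0.depth t1.depth
      omega

lemma DTree.eval_iff {m : ℕ} (t : DTree m) (y : Fin m → Bool) :
    t.eval y = true ↔ ∃ L ∈ t.terms, ∀ p ∈ L, y p.1 = p.2 := by
  induction t with
  | leaf b => cases b <;> simp [DTree.terms, DTree.eval]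
  | node i t0 t1 h0 h1 =>
    simp only [DTree.terms, DTree.eval, mem_union, mem_image]
    constructor
    · intro h
      cases hy : y i
      · rw [hy] at h
        obtain ⟨L, hL, hs⟩ := h0.1 (by simpa using h)
        refine ⟨insert (i, false) L, Or.inl ⟨L, hL, rfl⟩, ?_⟩
        intro p hp
        rcases mem_insert.1 hp with rfl | hp
        · exact hy
        · exact hs p hp
      · rw [hy] at h
        obtain ⟨L, hL, hs⟩ := h1.1 (by simpa using h)
        refine ⟨insert (i, true) L, Or.inr ⟨L, hL, rfl⟩, ?_⟩
        intro p hp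
        rcases mem_insert.1 hp with rfl | hp
        · exact hy
        · exact hs p hp
    · rintro ⟨L, ⟨L', hL', rfl⟩ | ⟨L', hL', rfl⟩, hs⟩
      · have hy : y i = false := hs _ (mem_insert_self _ _)
        rw [hy]
        simpa using h0.2 ⟨L', hL', fun p hp => hs p (mem_insert_of_mem hp)⟩
      · have hy : y i = true := hs _ (mem_insert_self _ _)
        rw [hy]
        simpa using h1.2 ⟨L', hL', fun p hp => hs p (mem_insert_of_mem hp)⟩

/-- combinatorial core of the argument -/
lemma structural {m n d q k : ℕ} (hn : 0 < n) (hq : 0 < q) (f : (Fin m → Bool) → (Fin n → Bool))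
    (hf : hasDecisionDepth f d) (η : ℝ) (hη : 0 < η)
    (hbig : 2 * k * (((2 * q) * (32 * (2 * q) * (d + 1))) ^ d : ℕ) ≤ η * n) :
    ∃ R : Finset (Fin n), (R.card : ℝ) ≤ η * n ∧
      ((univ.filter fun y : Fin m → Bool => wt (f y) = k ∧ ∃ i, i ∉ R ∧ f y i = true).card : ℝ)
        * η * 4 ^ q ≤ 2 ^ m * (2 * (32 * (2 * q) * (d + 1)) : ℕ) ^ d := by
  classical
  choose t ht1 ht2 using hf
  set κ := 32 * (2 * q) * (d + 1) with hκ
  have hκpos : 0 < κ := by positivity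
  have hκR : (0 : ℝ) < (κ : ℝ) ^ d := by positivity
  let F : Finset (Fin n × Finset (Fin m × Bool)) :=
    (univ : Finset (Fin n × Finset (Fin m × Bool))).filter fun x =>
      x.2 ∈ (t x.1).terms ∧ ∃ y : Fin m → Bool, ∀ p ∈ x.2, y p.1 = p.2
  have hFcard : F.card ≤ n * 2 ^ d := by
    have hsub : F ⊆ (univ : Finset (Fin n)).biUnion
        (fun i => (t i).terms.image (fun L => (i, L))) := by
      rintro ⟨i, L⟩ hx
      simp only [F, mem_filter, mem_univ, true_and] at hx
      simp only [mem_biUnion, mem_image, mem_univ, true_and]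
      exact ⟨i, L, hx.1, rfl⟩
    refine (card_le_card hsub).trans ?_
    refine card_biUnion_le.trans ?_
    calc _ ≤ ∑ i : Fin n, 2 ^ d := by
          refine sum_le_sum fun i _ => card_image_le.trans ((t i).card_terms.trans ?_)
          exact Nat.pow_le_pow_right (by norm_num) (ht1 i)
      _ = n * 2 ^ d := by simp
  let bad : Finset (Fin m × Bool) → Finset (Fin m → Bool) := fun T =>
    univ.filter fun y : Fin m → Bool => (∀ p ∈ T, y p.1 = p.2) ∧ wt (f y) ≤ k
  obtain ⟨C, hC1, hC2, hC3⟩ := covering (fun T => (bad T).card * 4 ^ q ≤ 2 ^ m)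
    (η * n / κ ^ d) (η * n) (by positivity) F (by
      intro I L hI hL
      have hLF : ∀ i ∈ I, L i ∈ (t i).terms ∧ ∃ y : Fin m → Bool, ∀ p ∈ L i, y p.1 = p.2 := by
        intro i hi
        have := hL i hi
        simpa only [F, mem_filter, mem_univ, true_and] using this
      obtain ⟨T, hT1, hT2⟩ := core I L d q k hq (fun i hi => (hLF i hi).2)
        (fun i hi => ((t i).terms_card_le _ (hLF i hi).1).trans (ht1 i))
        (by
          have := lt_of_le_of_lt hbig hI
          exact_mod_cast this)
      refine ⟨T, le_trans ?_ hT2, ?_⟩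
      · gcongr
        intro y hy
        simp only [bad, mem_filter, mem_univ, true_and] at hy ⊢
        refine ⟨hy.1, le_trans (card_le_card ?_) hy.2⟩
        intro i hi
        simp only [mem_filter, mem_univ, true_and] at hi ⊢
        rw [ht2]
        exact ((t i).eval_iff y).2 ⟨L i, (hLF i hi.1).1, hi.2⟩
      · rw [div_le_iff₀ hκR]
        have : (I.card : ℝ) ≤ κ ^ d * (I.filter fun i => T ⊆ L i).card := by exact_mod_cast hT1
        linarith)
  set R := (F.filter fun x => ∀ T ∈ C, ¬ T ⊆ x.2).image Prod.fst with hR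
  refine ⟨R, by convert hC3, ?_⟩
  have hsub : (univ.filter fun y : Fin m → Bool => wt (f y) = k ∧ ∃ i, i ∉ R ∧ f y i = true)
      ⊆ C.biUnion bad := by
    intro y hy
    simp only [mem_filter, mem_univ, true_and] at hy
    obtain ⟨hw, i, hi, hfi⟩ := hy
    rw [ht2] at hfi
    obtain ⟨L, hL, hs⟩ := ((t i).eval_iff y).1 hfi
    have hF : (i, L) ∈ F := by
      simp only [F, mem_filter, mem_univ, true_and]
      exact ⟨hL, y, hs⟩
    by_contra hcon
    apply hi
    refine mem_image.2 ⟨(i, L), mem_filter.2 ⟨hF, ?_⟩, rfl⟩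
    intro T hT hTL
    apply hcon
    refine mem_biUnion.2 ⟨T, hT, ?_⟩
    simp only [bad, mem_filter, mem_univ, true_and]
    exact ⟨fun p hp => hs p (hTL hp), hw.le⟩
  have hcardN : (univ.filter fun y : Fin m → Bool =>
      wt (f y) = k ∧ ∃ i, i ∉ R ∧ f y i = true).card * 4 ^ q ≤ C.card * 2 ^ m := by
    calc _ ≤ (∑ T ∈ C, (bad T).card) * 4 ^ q := by
          gcongr
          exact (card_le_card hsub).trans card_biUnion_le
      _ = ∑ T ∈ C, (bad T).card * 4 ^ q := sum_mul _ _ _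
      _ ≤ ∑ T ∈ C, 2 ^ m := sum_le_sum hC1
      _ = _ := by simp
  have hcardR : ((univ.filter fun y : Fin m → Bool =>
      wt (f y) = k ∧ ∃ i, i ∉ R ∧ f y i = true).card : ℝ) * 4 ^ q ≤ C.card * 2 ^ m := by
    exact_mod_cast hcardN
  have hnR : (0 : ℝ) < n := by exact_mod_cast hn
  have hCη : (C.card : ℝ) * η ≤ 2 ^ d * κ ^ d := by
    have h1 : (C.card : ℝ) * (η * n / κ ^ d) ≤ n * 2 ^ d := hC2.trans (by exact_mod_cast hFcard)
    rw [← mul_div_assoc, div_le_iff₀ hκR] at h1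
    refine le_of_mul_le_mul_left ?_ hnR
    linarith
  push_cast
  calc _ = ((univ.filter fun y : Fin m → Bool =>
      wt (f y) = k ∧ ∃ i, i ∉ R ∧ f y i = true).card : ℝ) * 4 ^ q * η := by ring
    _ ≤ C.card * 2 ^ m * η := by gcongr
    _ = 2 ^ m * (C.card * η) := by ring
    _ ≤ 2 ^ m * (2 ^ d * κ ^ d) := by gcongr
    _ = _ := by rw [mul_pow]

lemma le_SD {α : Type*} [Fintype α] (P Q : α → ℝ) (A : Finset α) :
    ∑ x ∈ A, Q x - ∑ x ∈ A, P x ≤ SD P Q := by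
  unfold SD
  have h := le_ciSup (f := fun A : Finset α => |∑ x ∈ A, P x - ∑ x ∈ A, Q x|)
    (Set.finite_range _).bddAbove A
  refine le_trans ?_ h
  have := neg_le_abs (∑ x ∈ A, P x - ∑ x ∈ A, Q x)
  linarith

lemma card_wt_subset {n k : ℕ} (R : Finset (Fin n)) :
    (univ.filter fun x : Fin n → Bool => wt x = k ∧ ∀ i, x i = true → i ∈ R).card
      = R.card.choose k := by
  classical
  rw [← card_powersetCard]
  refine card_bij' (fun x _ => univ.filter fun i => x i = true)
    (fun S _ => fun i => decide (i ∈ S)) ?_ ?_ ?_ ?_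
  · intro x hx
    simp only [mem_filter, mem_univ, true_and] at hx
    rw [mem_powersetCard]
    refine ⟨fun i hi => hx.2 i (by simpa using hi), hx.1⟩
  · intro S hS
    rw [mem_powersetCard] at hS
    rw [mem_filter]
    simp only [mem_univ, true_and, wt, decide_eq_true_eq, filter_univ_mem]
    exact ⟨hS.2, fun i hi => hS.1 hi⟩
  · intro x _
    funext i
    simp
  · intro S _
    simp

lemma choose_ratio {n k M : ℕ} (hk : 1 ≤ k) (hM : M ≤ n) :
    M.choose k * n ≤ n.choose k * M := by
  obtain ⟨k, rfl⟩ : ∃ j, k = j + 1 := ⟨k - 1, by omega⟩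
  rcases M with _ | M
  · simp
  obtain ⟨n, rfl⟩ : ∃ j, n = j + 1 := ⟨n - 1, by omega⟩
  have h1 := Nat.add_one_mul_choose_eq M k
  have h2 := Nat.add_one_mul_choose_eq n k
  have h3 : M.choose k ≤ n.choose k := Nat.choose_le_choose k (by omega)
  refine Nat.le_of_mul_le_mul_right ?_ (show 0 < k + 1 by omega)
  calc _ = ((M + 1).choose (k + 1) * (k + 1)) * (n + 1) := by ring
    _ = (M + 1) * M.choose k * (n + 1) := by rw [← h1]
    _ ≤ (M + 1) * n.choose k * (n + 1) := by gcongr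
    _ = ((n + 1) * n.choose k) * (M + 1) := by ring
    _ = _ := by rw [h2]; ring

/-- the statistical test -/
lemma slice_test {m n k : ℕ} (hk : 1 ≤ k) (hkn : k ≤ n) (f : (Fin m → Bool) → (Fin n → Bool))
    (R : Finset (Fin n)) :
    1 - (R.card : ℝ) / n -
      ((univ.filter fun y : Fin m → Bool => wt (f y) = k ∧ ∃ i, i ∉ R ∧ f y i = true).card : ℝ)
        / 2 ^ m ≤ SD (srcDist f) (uniformSlice n k) := by
  classical
  let A : Finset (Fin n → Bool) := univ.filter fun x => wt x = k ∧ ∃ i, i ∉ R ∧ x i = true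
  refine le_trans ?_ (le_SD _ _ A)
  have hP : ∑ x ∈ A, srcDist f x = ((univ.filter fun y : Fin m → Bool =>
      wt (f y) = k ∧ ∃ i, i ∉ R ∧ f y i = true).card : ℝ) / 2 ^ m := by
    unfold srcDist
    rw [← sum_div]
    congr 1
    rw [card_eq_sum_card_fiberwise (f := f) (t := A)]
    · push_cast
      refine sum_congr rfl fun x hx => ?_
      congr 2
      ext y
      simp only [mem_filter, mem_univ, true_and]
      constructor
      · intro h
        refine ⟨?_, h⟩
        rw [h]
        simpa [A] using hx
      · exact fun h => h.2
    · intro y hy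
      simpa [A] using hy
  have hnpos : (0 : ℝ) < n := by
    have : 0 < n := by omega
    exact_mod_cast this
  have hch : (0 : ℝ) < n.choose k := by exact_mod_cast Nat.choose_pos hkn
  have hQ : ∑ x ∈ A, uniformSlice n k x = (A.card : ℝ) / n.choose k := by
    rw [sum_congr rfl (g := fun _ => 1 / (n.choose k : ℝ))]
    · rw [sum_const, nsmul_eq_mul, mul_one_div]
    · intro x hx
      have : wt x = k := (mem_filter.1 hx).2.1
      simp [uniformSlice, this]
  have hA : A.card + R.card.choose k = n.choose k := by
    have h1 := card_wt_subset (n := n) (k := k) univ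
    have h2 := card_wt_subset (n := n) (k := k) R
    have h3 := card_filter_add_card_filter_not
      (s := univ.filter fun x : Fin n → Bool => wt x = k ∧ ∀ i, x i = true → i ∈ univ)
      (fun x => ∃ i, i ∉ R ∧ x i = true)
    rw [h1, card_univ, Fintype.card_fin] at h3
    rw [← h3, ← h2]
    congr 2
    · ext x; simp [A]
    · ext x
      simp only [mem_filter, mem_univ, true_and, not_exists, not_and, implies_true, and_true]
      refine and_congr_right fun _ => forall_congr' fun i => ?_
      tauto
  have hAR : (A.card : ℝ) = n.choose k - R.card.choose k := by
    rw [← hA]; push_cast; ring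
  have hr : ((R.card.choose k : ℕ) : ℝ) / n.choose k ≤ R.card / n := by
    rw [div_le_div_iff₀ hch hnpos]
    have := choose_ratio (n := n) (M := R.card) hk (by simpa using card_le_univ R)
    rw [mul_comm (R.card : ℝ)]
    exact_mod_cast this
  rw [hP, hQ, hAR, sub_div, div_self hch.ne']
  linarith

end main


lemma analytic (r : ℝ) (d : ℕ) (hr : Real.exp 2304 ≤ r)
    (hd : (d : ℝ) ≤ 1 / 8 * Real.log r / Real.log (Real.log r)) :
    ((((2 * ⌈2 * Real.log r⌉₊) * (32 * (2 * ⌈2 * Real.log r⌉₊) * (d + 1))) ^ d : ℕ) : ℝ)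
      ≤ Real.exp (Real.log r / 2) := by
  have hrpos : 0 < r := lt_of_lt_of_le (Real.exp_pos _) hr
  have hl : 2304 ≤ Real.log r := (Real.le_log_iff_exp_le hrpos).2 hr
  set l := Real.log r with hldef
  set q := ⌈2 * l⌉₊ with hq
  have hlpos : 0 < l := by linarith
  have hq3 : (q : ℝ) ≤ 3 * l := by
    have := Nat.ceil_lt_add_one (show 0 ≤ 2 * l by positivity)
    rw [← hq] at this
    linarith
  have hlam : 1 ≤ Real.log l := by
    rw [Real.le_log_iff_exp_le hlpos]
    linarith [Real.exp_one_lt_d9]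
  have hdl : (d : ℝ) * Real.log l ≤ l / 8 := by
    rw [le_div_iff₀ (by linarith)] at hd
    linarith
  have hd1 : (d : ℝ) + 1 ≤ 2 * l := by
    have : (d : ℝ) ≤ d * Real.log l := le_mul_of_one_le_right (by positivity) hlam
    linarith
  have hX : (2 * (q : ℝ)) * (32 * (2 * q) * (d + 1)) ≤ l ^ 4 := by
    calc (2 * (q : ℝ)) * (32 * (2 * q) * (d + 1))
        ≤ (2 * (3 * l)) * (32 * (2 * (3 * l)) * (2 * l)) := by gcongr
      _ = 2304 * l ^ 3 := by ring
      _ ≤ l * l ^ 3 := by gcongr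
      _ = l ^ 4 := by ring
  push_cast
  calc _ ≤ (l ^ 4) ^ d := by gcongr
    _ = Real.exp (4 * (d * Real.log l)) := by
      rw [← pow_mul, ← Real.exp_log (show 0 < l ^ (4 * d) by positivity), Real.log_pow]
      congr 1
      push_cast
      ring
    _ ≤ Real.exp (l / 2) := by
      apply Real.exp_le_exp.2
      linarith

/-- For every `ε > 0` there is a constant `τ > 0` such that for all
sufficiently large `n` and all `k` with `1 ≤ k ≤ n` and `n/k` sufficiently large (in terms
of `ε`): any distribution on `{0,1}^n` sampled with decision depth
`d ≤ τ · log(n/k) / log log(n/k)` is `(1-ε)`-far from `U_k^n`. -/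
theorem stmt0 :
    ∀ ε : ℝ, 0 < ε → ∃ τ : ℝ, 0 < τ ∧ ∃ N₀ N₁ : ℕ, ∀ n k : ℕ,
      N₀ ≤ n → 1 ≤ k → k ≤ n → (N₁ : ℝ) ≤ (n : ℝ) / (k : ℝ) →
      ∀ (m d : ℕ) (f : (Fin m → Bool) → (Fin n → Bool)),
        hasDecisionDepth f d →
        (d : ℝ) ≤ τ * Real.log ((n : ℝ) / (k : ℝ)) / Real.log (Real.log ((n : ℝ) / (k : ℝ))) →
        1 - ε ≤ SD (srcDist f) (uniformSlice n k) := by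
  intro ε hε
  refine ⟨1 / 8, by norm_num, 0, ⌈max (Real.exp 2304) (16 / ε ^ 2)⌉₊, ?_⟩
  intro n k _ hk hkn hN m d f hf hd
  have hk0 : (0 : ℝ) < k := by exact_mod_cast hk
  have hn : 0 < n := by omega
  have hn0 : (0 : ℝ) < n := by exact_mod_cast hn
  set r : ℝ := (n : ℝ) / k with hr
  have hrmax := (Nat.le_ceil (max (Real.exp 2304) (16 / ε ^ 2))).trans hN
  have hr1 : Real.exp 2304 ≤ r := (le_max_left _ _).trans hrmax
  have hr2 : 16 / ε ^ 2 ≤ r := (le_max_right _ _).trans hrmax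
  have hrpos : 0 < r := lt_of_lt_of_le (Real.exp_pos _) hr1
  have hl : 2304 ≤ Real.log r := (Real.le_log_iff_exp_le hrpos).2 hr1
  have hana := analytic r d hr1 hd
  set q := ⌈2 * Real.log r⌉₊ with hq
  set s := Real.exp (Real.log r / 2) with hs
  have hspos : 0 < s := Real.exp_pos _
  have hss : s * s = r := by
    rw [hs, ← Real.exp_add, add_halves, Real.exp_log hrpos]
  have hs1 : 1 ≤ s := Real.one_le_exp (by linarith)
  have hq2 : 2 * Real.log r ≤ q := Nat.le_ceil _
  have hq0 : 0 < q := by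
    have : (0 : ℝ) < q := by linarith
    exact_mod_cast this
  have hes : 4 ≤ ε * s := by
    have h1 : 16 ≤ r * ε ^ 2 := (div_le_iff₀ (by positivity)).1 hr2
    have h2 : (4 : ℝ) ^ 2 ≤ (ε * s) ^ 2 := by
      rw [mul_pow, sq s, hss]
      linarith
    exact le_of_sq_le_sq h2 (by positivity)
  have h4q : r * r ≤ 4 ^ q := by
    have h1 : Real.exp 1 ≤ 4 := by linarith [Real.exp_one_lt_d9]
    calc r * r = Real.exp (2 * Real.log r) := by
          rw [two_mul, Real.exp_add, Real.exp_log hrpos]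
      _ ≤ Real.exp (q * 1) := by
          apply Real.exp_le_exp.2
          linarith
      _ = Real.exp 1 ^ q := Real.exp_nat_mul _ _
      _ ≤ 4 ^ q := by gcongr
  obtain ⟨R, hR1, hR2⟩ := structural (k := k) (d := d) hn hq0 f hf (ε / 2) (by positivity) (by
    have hnr : (n : ℝ) = r * k := by
      rw [hr]
      field_simp
    rw [hnr]
    calc _ ≤ 2 * (k : ℝ) * s := by gcongr
      _ ≤ ε / 2 * (r * k) := by
        rw [← hss]
        have : 2 * (k : ℝ) * s * 4 ≤ 2 * (k : ℝ) * s * (ε * s) := by gcongr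
        linarith)
  refine le_trans ?_ (slice_test hk hkn f R)
  set c : ℝ := ((univ.filter fun y : Fin m → Bool =>
    wt (f y) = k ∧ ∃ i, i ∉ R ∧ f y i = true).card : ℝ) with hc
  have hRn : (R.card : ℝ) / n ≤ ε / 2 := by
    rw [div_le_iff₀ hn0]
    exact hR1
  have hκ : (((2 * (32 * (2 * q) * (d + 1)) : ℕ) : ℝ)) ^ d ≤ s := by
    refine le_trans ?_ hana
    push_cast
    have : (1 : ℝ) ≤ q := by exact_mod_cast hq0
    gcongr
    linarith
  have hcm : c / 2 ^ m ≤ ε / 2 := by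
    rw [div_le_iff₀ (by positivity)]
    have h1 : c * (ε / 2) * (r * r) ≤ 2 ^ m * s := by
      calc c * (ε / 2) * (r * r) ≤ c * (ε / 2) * 4 ^ q := by gcongr
        _ ≤ _ := hR2
        _ ≤ 2 ^ m * s := by gcongr
    have h2 : s ≤ ε / 2 * (ε / 2) * (r * r) := by
      rw [← hss]
      have h3 : (4 : ℝ) * 4 ≤ (ε * s) * (ε * s) := by gcongr
      have h4 : s ≤ s * s := by nlinarith
      have h5 : 4 * 4 * (s * s) ≤ (ε * s) * (ε * s) * (s * s) := by gcongr
      nlinarith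
    have h6 : c * ((ε / 2) * (r * r)) ≤ (ε / 2 * 2 ^ m) * ((ε / 2) * (r * r)) := by
      have h7 : (2 : ℝ) ^ m * s ≤ 2 ^ m * (ε / 2 * (ε / 2) * (r * r)) := by gcongr
      linarith
    exact le_of_mul_le_mul_right h6 (by positivity)
  linarith
end

section
/- There exist constants τ > 0 and c > 0 such that for all sufficiently large n, every distribution X on {0,1}^n sampled with decision depth at most τ · log n / log log n satisfies Δ(X, U_1^n) ≥ 1 − n^{−c}. -/
open Finset

def Sat {m : ℕ} {α : Type*} (z : Fin m → α) (T : Finset (Fin m × α)) : Prop :=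
  ∀ p ∈ T, z p.1 = p.2

open Classical in
lemma card_sat_eq {m : ℕ} {α : Type*} [Fintype α] (T : Finset (Fin m × α)) (z0 : Fin m → α)
    (h : Sat z0 T) :
    (univ.filter fun z : Fin m → α => Sat z T).card * Fintype.card α ^ T.card
      = Fintype.card α ^ m := by
  set D := T.image Prod.fst with hD
  have hc : D.card = T.card := by
    apply Finset.card_image_of_injOn
    intro p hp q hq hpq
    have := h p hp
    have := h q hq
    ext <;> simp_all
  have heq : (univ.filter fun z : Fin m → α => Sat z T)
      = Fintype.piFinset (fun v => if v ∈ D then {z0 v} else (univ : Finset α)) := by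
    ext z
    simp only [mem_filter, mem_univ, true_and, Fintype.mem_piFinset]
    constructor
    · intro hz v
      split_ifs with hv
      · rw [hD, Finset.mem_image] at hv
        obtain ⟨p, hp, rfl⟩ := hv
        simp [hz p hp, h p hp]
      · simp
    · intro hz p hp
      have := hz p.1
      rw [if_pos (Finset.mem_image_of_mem _ hp)] at this
      rw [Finset.mem_singleton.1 this, h p hp]
  rw [heq, Fintype.card_piFinset]
  have : ∀ v, (if v ∈ D then {z0 v} else (univ : Finset α)).card
      = if v ∈ D then 1 else Fintype.card α := by
    intro v; split_ifs <;> simp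
  simp_rw [this]
  rw [Finset.prod_ite, prod_const_one, one_mul, prod_const, ← hc, ← pow_add]
  congr 1
  have := Finset.card_filter_add_card_filter_not (s := (univ : Finset (Fin m))) (fun v => v ∈ D)
  simp at this
  have h2 : (univ.filter fun v => v ∈ D) = D := by ext; simp
  simp at *
  omega

open Classical in
lemma card_sat_le {m : ℕ} {α : Type*} [Fintype α] (T : Finset (Fin m × α)) :
    (univ.filter fun z : Fin m → α => Sat z T).card * Fintype.card α ^ T.card
      ≤ Fintype.card α ^ m := by
  by_cases h : ∃ z0, Sat z0 T
  · obtain ⟨z0, h⟩ := h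
    exact (card_sat_eq T z0 h).le
  · have : (univ.filter fun z : Fin m → α => Sat z T) = ∅ := by
      ext z
      simp
      exact fun hz => h ⟨z, hz⟩
    rw [this]; simp

lemma sat_union {m : ℕ} {α : Type*} [DecidableEq α] (z : Fin m → α)
    (T U : Finset (Fin m × α)) : Sat z (T ∪ U) ↔ Sat z T ∧ Sat z U := by
  unfold Sat
  constructor
  · intro h
    exact ⟨fun p hp => h p (mem_union_left _ hp), fun p hp => h p (mem_union_right _ hp)⟩
  · rintro ⟨h1, h2⟩ p hp
    rcases mem_union.1 hp with h | h
    exacts [h1 p h, h2 p h]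

/-- Independence of events on complementary coordinate sets. -/
lemma indep_two {m : ℕ} (D : Finset (Fin m)) (E F : Finset (Fin m → Bool))
    (hE : ∀ y y', (∀ v ∈ D, y v = y' v) → y ∈ E → y' ∈ E)
    (hF : ∀ y y', (∀ v, v ∉ D → y v = y' v) → y ∈ F → y' ∈ F) :
    (E ∩ F).card * 2 ^ m = E.card * F.card := by
  have h2 : (univ : Finset (Fin m → Bool)).card = 2 ^ m := by simp
  rw [← h2, ← card_product, ← card_product]
  refine Finset.card_bij' (fun p _ => (D.piecewise p.1 p.2, D.piecewise p.2 p.1))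
    (fun p _ => (D.piecewise p.1 p.2, D.piecewise p.2 p.1)) ?_ ?_ ?_ ?_
  · rintro ⟨y, y'⟩ h
    simp only [mem_product, mem_inter, mem_univ, and_true] at h ⊢
    refine ⟨hE y _ ?_ h.1, hF y _ ?_ h.2⟩
    · intro v hv; simp [hv]
    · intro v hv; simp [hv]
  · rintro ⟨y, y'⟩ h
    simp only [mem_product, mem_inter, mem_univ, and_true] at h ⊢
    refine ⟨hE y _ ?_ h.1, hF y' _ ?_ h.2⟩
    · intro v hv; simp [hv]
    · intro v hv; simp [hv]
  · rintro ⟨y, y'⟩ h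
    ext v <;> by_cases hv : v ∈ D <;> simp [hv]
  · rintro ⟨y, y'⟩ h
    ext v <;> by_cases hv : v ∈ D <;> simp [hv]

open Classical in
lemma indep_many {m r : ℕ} (π : Fin m → Fin r) (E : Fin r → Finset (Fin m → Bool))
    (hE : ∀ b y y', (∀ v, π v = b → y v = y' v) → y ∈ E b → y' ∈ E b) (B : Finset (Fin r)) :
    (univ.filter fun y => ∀ b ∈ B, y ∈ E b).card * (2 ^ m) ^ B.card
      = 2 ^ m * ∏ b ∈ B, (E b).card := by
  induction B using Finset.induction_on with
  | empty => simp
  | insert b B hb ih =>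
    have h := indep_two (univ.filter fun v => π v = b) (E b)
      (univ.filter fun y => ∀ b ∈ B, y ∈ E b)
      (fun y y' h => hE b y y' (fun v hv => h v (by simpa using hv)))
      (fun y y' h hy => by
        simp only [mem_filter, mem_univ, true_and] at hy ⊢
        intro b' hb'
        refine hE b' y y' (fun v hv => h v ?_) (hy b' hb')
        simp
        rintro rfl
        exact hb (hv ▸ hb'))
    have heq : (univ.filter fun y => ∀ b' ∈ insert b B, y ∈ E b')
        = E b ∩ (univ.filter fun y => ∀ b ∈ B, y ∈ E b) := by
      ext y; simp
    rw [heq, card_insert_of_notMem hb, prod_insert hb, pow_succ]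
    calc _ = ((E b ∩ (univ.filter fun y => ∀ b ∈ B, y ∈ E b)).card * 2 ^ m)
          * (2 ^ m) ^ B.card := by ring
      _ = _ := by rw [h, mul_assoc, ih]; ring

/-- embedding of literals into a block. -/
def blk {m : ℕ} {α : Type*} (e : Bool ↪ α) : (Fin m × Bool) ↪ (Fin m × α) :=
  ⟨fun p => (p.1, e p.2), by
    rintro ⟨a, b⟩ ⟨c, d⟩ h
    simp at h
    simp [h.1, h.2]⟩

open Classical in
lemma second_moment {m d : ℕ} {α ι : Type*} [Fintype α] (e : Bool ↪ α) (I : Finset ι)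
    (hI : I.Nonempty) (T : ι → Finset (Fin m × Bool)) (hsat : ∀ i ∈ I, ∃ y, Sat y (T i))
    (hd : ∀ i ∈ I, (T i).card ≤ d) (t : ℝ) (ht : 4 * (d + 1) * (Fintype.card α : ℝ) ≤ t)
    (hspread : ∀ L : Finset (Fin m × Bool), L.Nonempty →
      ((I.filter fun i => L ⊆ T i).card : ℝ) * t ^ L.card ≤ I.card) :
    4 * ((univ.filter fun z : Fin m → α => ∀ i ∈ I, ¬ Sat z ((T i).map (blk e))).card : ℝ)
      ≤ (Fintype.card α : ℝ) ^ m := by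
  set s : ℝ := (Fintype.card α : ℝ) with hs
  have hs1 : 1 ≤ s := by
    have : 0 < Fintype.card α := Fintype.card_pos_iff.2 ⟨e true⟩
    rw [hs]; exact_mod_cast this
  have htpos : 0 < t := by
    have : (0:ℝ) < 4 * (d + 1) * s := by positivity
    linarith
  set N : ℝ := (I.card : ℝ) with hN
  have hNpos : 0 < N := by rw [hN]; exact_mod_cast hI.card_pos
  set G := univ.filter fun z : Fin m → α => ∃ i ∈ I, Sat z ((T i).map (blk e)) with hG
  have hcompl : ((univ.filter fun z : Fin m → α => ∀ i ∈ I, ¬ Sat z ((T i).map (blk e))).card : ℝ)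
      = s ^ m - G.card := by
    have := Finset.card_filter_add_card_filter_not (s := (univ : Finset (Fin m → α)))
      (fun z => ∃ i ∈ I, Sat z ((T i).map (blk e)))
    simp only [not_exists, not_and, card_univ, Fintype.card_fun, Fintype.card_fin] at this
    rw [hs, hG, eq_sub_iff_add_eq, add_comm]
    exact_mod_cast this
  rw [hcompl]
  set Z : (Fin m → α) → ℝ := fun z =>
    ∑ i ∈ I, if Sat z ((T i).map (blk e)) then s ^ (T i).card else 0 with hZ
  have hsum : ∑ z, Z z = N * s ^ m := by
    rw [hZ, sum_comm]
    rw [hN, ← nsmul_eq_mul]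
    rw [← sum_const]
    apply sum_congr rfl
    intro i hi
    rw [← sum_filter, sum_const, nsmul_eq_mul]
    obtain ⟨y, hy⟩ := hsat i hi
    have h := card_sat_eq ((T i).map (blk e)) (fun v => e (y v)) (by
      intro p hp
      obtain ⟨q, hq, rfl⟩ := Finset.mem_map.1 hp
      show e (y q.1) = e q.2
      rw [hy q hq])
    rw [card_map] at h
    rw [hs]
    exact_mod_cast h
  have hsq : ∑ z, Z z ^ 2 ≤ N ^ 2 * (1 + s / t) ^ d * s ^ m := by
    have h1 : ∑ z, Z z ^ 2 = ∑ i ∈ I, ∑ j ∈ I,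
        ((univ.filter fun z : Fin m → α => Sat z ((T i ∪ T j).map (blk e))).card : ℝ)
          * (s ^ (T i).card * s ^ (T j).card) := by
      simp_rw [hZ, sq, sum_mul_sum]
      rw [sum_comm]
      apply sum_congr rfl
      intro i hi
      rw [sum_comm]
      apply sum_congr rfl
      intro j hj
      rw [← nsmul_eq_mul, ← sum_const, sum_filter]
      apply sum_congr rfl
      intro z _
      rw [map_union]
      simp only [sat_union]
      by_cases h1 : Sat z ((T i).map (blk e)) <;> by_cases h2 : Sat z ((T j).map (blk e)) <;>
        simp [h1, h2]
    rw [h1]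
    have h2 : ∀ i ∈ I, ∑ j ∈ I,
        ((univ.filter fun z : Fin m → α => Sat z ((T i ∪ T j).map (blk e))).card : ℝ)
          * (s ^ (T i).card * s ^ (T j).card) ≤ N * (1 + s / t) ^ d * s ^ m := by
      intro i hi
      have h3 : ∀ j ∈ I,
        ((univ.filter fun z : Fin m → α => Sat z ((T i ∪ T j).map (blk e))).card : ℝ)
          * (s ^ (T i).card * s ^ (T j).card)
          ≤ (∑ L ∈ (T i).powerset, if L ⊆ T j then s ^ L.card else 0) * s ^ m := by
        intro j hj
        have hc := card_sat_le ((T i ∪ T j).map (blk e))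
        rw [card_map] at hc
        have hc' : ((univ.filter fun z : Fin m → α => Sat z ((T i ∪ T j).map (blk e))).card : ℝ)
          * s ^ (T i ∪ T j).card ≤ s ^ m := by rw [hs]; exact_mod_cast hc
        rw [← pow_add, ← card_union_add_card_inter, pow_add, ← mul_assoc]
        rw [mul_comm]
        refine mul_le_mul ?_ hc' (by positivity) ?_
        · have := Finset.single_le_sum (f := fun L => if L ⊆ T j then s ^ L.card else 0)
            (s := (T i).powerset) (fun L _ => by positivity)
            (a := T i ∩ T j) (by simp [inter_subset_left])
          simpa [inter_subset_right] using this
        · exact sum_nonneg fun L _ => by positivity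
      refine (sum_le_sum h3).trans ?_
      rw [← sum_mul]
      refine mul_le_mul_of_nonneg_right ?_ (by positivity)
      rw [sum_comm]
      have h4 : ∀ L ∈ (T i).powerset, (∑ j ∈ I, if L ⊆ T j then s ^ L.card else 0)
          ≤ N * ((s / t) ^ L.card * 1 ^ ((T i).card - L.card)) := by
        intro L _
        rw [← sum_filter, sum_const, nsmul_eq_mul, one_pow, mul_one, div_pow]
        rcases L.eq_empty_or_nonempty with rfl | hL
        · simp [hN]
        · have := hspread L hL
          have htp : 0 < t ^ L.card := by positivity
          rw [← mul_div_assoc, le_div_iff₀ htp]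
          have hsp : 0 ≤ s ^ L.card := by positivity
          nlinarith
      refine (sum_le_sum h4).trans ?_
      rw [← mul_sum, sum_pow_mul_eq_add_pow, add_comm]
      refine mul_le_mul_of_nonneg_left ?_ hNpos.le
      refine pow_le_pow_right₀ ?_ (hd i hi)
      have : 0 ≤ s / t := by positivity
      linarith
    refine (sum_le_sum h2).trans (le_of_eq ?_)
    rw [sum_const, nsmul_eq_mul]
    ring
  have hcs : (N * s ^ m) ^ 2 ≤ G.card * (N ^ 2 * (1 + s / t) ^ d * s ^ m) := by
    have h0 : ∑ z, Z z = ∑ z ∈ G, Z z := by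
      symm
      apply sum_subset (subset_univ _)
      intro z _ hz
      apply sum_eq_zero
      intro i hi
      rw [if_neg]
      intro h
      exact hz (by simp only [hG, mem_filter, mem_univ, true_and]; exact ⟨i, hi, h⟩)
    rw [← hsum, h0]
    refine sq_sum_le_card_mul_sum_sq.trans ?_
    refine mul_le_mul_of_nonneg_left (le_trans ?_ hsq) (by positivity)
    exact sum_le_sum_of_subset_of_nonneg (subset_univ _) fun _ _ _ => sq_nonneg _
  have hspos : 0 < s ^ m := by positivity
  have h5 : s ^ m ≤ G.card * (1 + s / t) ^ d := by
    have : 0 < N ^ 2 * s ^ m := by positivity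
    refine le_of_mul_le_mul_left ?_ this
    nlinarith
  have hx0 : 0 ≤ s / t := by positivity
  have hx : 4 * (d + 1) * (s / t) ≤ 1 := by
    rw [← mul_div_assoc, div_le_one htpos]; exact ht
  set x := s / t
  have hd0 : (0:ℝ) ≤ d := by positivity
  have hx1 : x ≤ 1 := by nlinarith
  have hdx : d * x ≤ 1 / 4 := by nlinarith
  have h6 : 1 + (d:ℝ) * (-x) ≤ (1 + -x) ^ d := one_add_mul_le_pow (by linarith) d
  have h7 : (1 + x) ^ d * (1 + -x) ^ d ≤ 1 := by
    rw [← mul_pow]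
    apply pow_le_one₀ <;> nlinarith
  have h8 : s ^ m * (1 - d * x) ≤ G.card := by
    calc s ^ m * (1 - d * x) ≤ (G.card * (1 + x) ^ d) * (1 + -x) ^ d := by
          apply mul_le_mul h5 (by linarith) (by linarith) (by positivity)
      _ = G.card * ((1 + x) ^ d * (1 + -x) ^ d) := by ring
      _ ≤ G.card * 1 := by
          apply mul_le_mul_of_nonneg_left h7 (by positivity)
      _ = _ := by ring
  nlinarith

open Classical in
lemma spread_cover {m d r : ℕ} {ι : Type*} (hr : 0 < r) (I : Finset ι)
    (hI : I.Nonempty) (T : ι → Finset (Fin m × Bool)) (hsat : ∀ i ∈ I, ∃ y, Sat y (T i))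
    (hd : ∀ i ∈ I, (T i).card ≤ d) (t : ℝ) (ht : 8 * (d + 1) * (r : ℝ) ≤ t)
    (hspread : ∀ L : Finset (Fin m × Bool), L.Nonempty →
      ((I.filter fun i => L ⊆ T i).card : ℝ) * t ^ L.card ≤ I.card) :
    ((univ.filter fun y : Fin m → Bool => ∀ i ∈ I, ¬ Sat y (T i)).card : ℝ) * 4 ^ r
      ≤ 2 ^ m := by
  set e : Fin r → (Bool ↪ Fin r × Bool) := fun b => ⟨fun x => (b, x), by intro x y h; simpa using h⟩
    with he
  set g : (Fin m → Fin r) → Fin r → Finset (Fin m → Bool) := fun π b =>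
    univ.filter fun y => ∀ i ∈ I, ¬ Sat (fun v => (π v, y v)) ((T i).map (blk (e b))) with hg
  have hcount : ∀ b, ((univ.filter fun z : Fin m → Fin r × Bool =>
      ∀ i ∈ I, ¬ Sat z ((T i).map (blk (e b)))).card : ℝ) = ∑ π, ((g π b).card : ℝ) := by
    intro b
    rw [← Nat.cast_sum]
    congr 1
    rw [← Finset.card_sigma]
    refine Finset.card_bij' (fun z _ => ⟨fun v => (z v).1, fun v => (z v).2⟩)
      (fun p _ => fun v => (p.1 v, p.2 v)) ?_ ?_ ?_ ?_
    · intro z hz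
      simpa [hg] using hz
    · rintro ⟨π, y⟩ hz
      simpa [hg] using hz
    · intro z hz; rfl
    · rintro ⟨π, y⟩ hz; rfl
  have hsum : ∑ π : Fin m → Fin r, ∑ b, 4 * ((g π b).card : ℝ)
      ≤ ∑ π : Fin m → Fin r, (r : ℝ) * 2 ^ m := by
    rw [sum_comm]
    have : ∀ b ∈ (univ : Finset (Fin r)), ∑ π, 4 * ((g π b).card : ℝ) ≤ (2 * r) ^ m := by
      intro b _
      rw [← mul_sum, ← hcount]
      have := second_moment (e b) I hI T hsat hd t (by simp; linarith) hspread
      simpa [mul_comm] using this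
    refine (sum_le_sum this).trans (le_of_eq ?_)
    simp
    ring
  have : Nonempty (Fin r) := ⟨⟨0, hr⟩⟩
  obtain ⟨π, -, hπ⟩ := exists_le_of_sum_le univ_nonempty hsum
  have hind := indep_many π (g π) (by
    intro b y y' hyy' hy
    simp only [hg, mem_filter, mem_univ, true_and] at hy ⊢
    intro i hi hs
    refine hy i hi ?_
    intro p hp
    obtain ⟨q, hq, rfl⟩ := Finset.mem_map.1 hp
    have this : (π q.1, y' q.1) = (b, q.2) := hs _ hp
    show (π q.1, y q.1) = (b, q.2)
    rw [Prod.mk.injEq] at this ⊢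
    refine ⟨this.1, ?_⟩
    rw [hyy' _ this.1]; exact this.2) univ
  have hsub : (univ.filter fun y : Fin m → Bool => ∀ i ∈ I, ¬ Sat y (T i))
      ⊆ (univ.filter fun y => ∀ b ∈ (univ : Finset (Fin r)), y ∈ g π b) := by
    intro y hy
    simp only [hg, mem_filter, mem_univ, true_and, true_implies] at hy ⊢
    intro b i hi hs
    refine hy i hi fun q hq => ?_
    have this : (π q.1, y q.1) = (b, q.2) := hs _ (Finset.mem_map_of_mem _ hq)
    exact (Prod.mk.injEq _ _ _ _ ▸ this).2
  have hcard := card_le_card hsub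
  have hprod : ∏ b, (4 * ((g π b).card : ℝ) / 2 ^ m) ≤ 1 := by
    calc ∏ b, (4 * ((g π b).card : ℝ) / 2 ^ m)
        ≤ ∏ b, Real.exp (4 * ((g π b).card : ℝ) / 2 ^ m - 1) := by
          apply prod_le_prod
          · intros; positivity
          · intro b _
            have := Real.add_one_le_exp (4 * ((g π b).card : ℝ) / 2 ^ m - 1)
            linarith
      _ = Real.exp (∑ b, (4 * ((g π b).card : ℝ) / 2 ^ m - 1)) := (Real.exp_sum _ _).symm
      _ ≤ 1 := by
          rw [Real.exp_le_one_iff, sum_sub_distrib, ← sum_div]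
          simp only [sum_const, card_univ, Fintype.card_fin, nsmul_eq_mul, mul_one]
          rw [sub_nonpos, div_le_iff₀ (by positivity)]
          exact hπ
  have hind' : ((univ.filter fun y => ∀ b ∈ (univ : Finset (Fin r)), y ∈ g π b).card : ℝ)
      * (2 ^ m) ^ r = 2 ^ m * ∏ b, ((g π b).card : ℝ) := by
    have h := congrArg (Nat.cast (R := ℝ)) hind
    push_cast at h
    simpa using h
  rw [prod_div_distrib, prod_mul_distrib] at hprod
  simp only [prod_const, card_univ, Fintype.card_fin] at hprod
  rw [div_le_one (by positivity)] at hprod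
  have hcard' : ((univ.filter fun y : Fin m → Bool => ∀ i ∈ I, ¬ Sat y (T i)).card : ℝ)
    ≤ ((univ.filter fun y => ∀ b ∈ (univ : Finset (Fin r)), y ∈ g π b).card : ℝ) := by
    exact_mod_cast hcard
  have hp : (0:ℝ) < (2 ^ m) ^ r := by positivity
  refine le_of_mul_le_mul_right ?_ hp
  calc _ ≤ ((univ.filter fun y => ∀ b ∈ (univ : Finset (Fin r)), y ∈ g π b).card : ℝ) * 4 ^ r
        * (2 ^ m) ^ r := by gcongr
    _ = 4 ^ r * (2 ^ m * ∏ b, ((g π b).card : ℝ)) := by rw [← hind']; ring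
    _ = 2 ^ m * (4 ^ r * ∏ b, ((g π b).card : ℝ)) := by ring
    _ ≤ 2 ^ m * (2 ^ m) ^ r := by gcongr

/-- Robust sunflower type statement. -/
lemma robust {m d r : ℕ} {ι : Type*} [DecidableEq ι] (hr : 0 < r) (S : Finset ι)
    (T : ι → Finset (Fin m × Bool)) (hsat : ∀ i ∈ S, ∃ y, Sat y (T i))
    (hd : ∀ i ∈ S, (T i).card ≤ d) (hS : (24 * (d + 1) * r) ^ d < S.card) :
    ∃ i ∈ S, ∃ K ⊆ T i, ∃ I J : Finset ι, I ⊆ S ∧ J ⊆ S ∧ Disjoint I J ∧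
      (∀ E : Finset (Fin m → Bool), (∀ y ∈ E, Sat y K ∧ ∀ i ∈ I, ¬ Sat y (T i)) →
        (E.card : ℝ) * 4 ^ r ≤ 2 ^ m) ∧
      (∀ E : Finset (Fin m → Bool), (∀ y ∈ E, Sat y K ∧ ∀ i ∈ J, ¬ Sat y (T i)) →
        (E.card : ℝ) * 4 ^ r ≤ 2 ^ m) := by
  classical
  set t := 24 * (d + 1) * r with ht
  have ht1 : 1 ≤ t := by rw [ht]; exact Nat.mul_pos (by positivity) hr
  obtain ⟨K, -, hK⟩ := exists_max_image (univ : Finset (Finset (Fin m × Bool)))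
    (fun K => (S.filter fun i => K ⊆ T i).card * t ^ K.card) univ_nonempty
  have h0 := hK ∅ (mem_univ _)
  simp only [empty_subset, filter_true, card_empty, pow_zero, mul_one] at h0
  set P := S.filter fun i => K ⊆ T i with hP
  have hPne : P.Nonempty := by
    rw [nonempty_iff_ne_empty]
    intro h
    rw [h] at h0
    simp at h0
    simp [h0] at hS
  obtain ⟨i0, hi0⟩ := hPne
  have hi0' := mem_filter.1 hi0
  have hKd : K.card ≤ d := (card_le_card hi0'.2).trans (hd _ hi0'.1)
  have hP2 : 2 ≤ P.card := by
    by_contra hlt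
    have : P.card * t ^ K.card ≤ 1 * t ^ d :=
      Nat.mul_le_mul (by omega) (Nat.pow_le_pow_right ht1 hKd)
    omega
  obtain ⟨I, hIP, hIc⟩ := exists_subset_card_eq (s := P) (n := P.card / 2) (by omega)
  have key : ∀ I ⊆ P, P.card ≤ 3 * I.card → ∀ E : Finset (Fin m → Bool),
      (∀ y ∈ E, Sat y K ∧ ∀ i ∈ I, ¬ Sat y (T i)) → (E.card : ℝ) * 4 ^ r ≤ 2 ^ m := by
    intro I hIP hIc E hE
    have hIS : ∀ i ∈ I, i ∈ S ∧ K ⊆ T i := fun i hi => mem_filter.1 (hIP hi)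
    have h := spread_cover (d := d) hr I (card_pos.1 (by omega)) (fun i => T i \ K)
      (by
        intro i hi
        obtain ⟨y, hy⟩ := hsat i (hIS i hi).1
        exact ⟨y, fun p hp => hy p (mem_sdiff.1 hp).1⟩)
      (fun i hi => (card_le_card sdiff_subset).trans (hd i (hIS i hi).1))
      (8 * (d + 1) * r) le_rfl
      (by
        intro L hL
        by_cases hdisj : Disjoint L K
        · have h1 := hK (K ∪ L) (mem_univ _)
          rw [card_union_of_disjoint hdisj.symm, pow_add] at h1
          have hcard : (I.filter fun i => L ⊆ T i \ K).card
              ≤ (S.filter fun i => K ∪ L ⊆ T i).card := by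
            apply card_le_card
            intro i hi
            obtain ⟨hi, hL⟩ := mem_filter.1 hi
            exact mem_filter.2 ⟨(hIS i hi).1, union_subset (hIS i hi).2 (hL.trans sdiff_subset)⟩
          have h2 : (S.filter fun i => K ∪ L ⊆ T i).card * t ^ L.card ≤ P.card := by
            have : 0 < t ^ K.card := by positivity
            refine Nat.le_of_mul_le_mul_right ?_ this
            calc _ = #{i ∈ S | K ∪ L ⊆ T i} * (t ^ #K * t ^ #L) := by ring
              _ ≤ _ := h1
          have h3 : (I.filter fun i => L ⊆ T i \ K).card * t ^ L.card ≤ 3 * I.card :=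
            (Nat.mul_le_mul_right _ hcard).trans (h2.trans hIc)
          have h4 : 3 * (8 * (d + 1) * r) ^ L.card ≤ t ^ L.card := by
            have : t = 3 * (8 * (d + 1) * r) := by rw [ht]; ring
            rw [this, mul_pow 3]
            apply Nat.mul_le_mul_right
            exact Nat.le_self_pow (by simpa using hL.ne_empty) 3
          have h5 : (I.filter fun i => L ⊆ T i \ K).card * (8 * (d + 1) * r) ^ L.card ≤ I.card := by
            have := Nat.mul_le_mul_left (I.filter fun i => L ⊆ T i \ K).card h4
            have h6 : 3 * ((I.filter fun i => L ⊆ T i \ K).card * (8 * (d + 1) * r) ^ L.card)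
                ≤ 3 * I.card := by
              calc _ = _ := by ring
                _ ≤ _ := this.trans h3
            omega
          exact_mod_cast h5
        · have : (I.filter fun i => L ⊆ T i \ K) = ∅ := by
            rw [filter_eq_empty_iff]
            intro i _ hL
            exact hdisj (disjoint_of_subset_left hL sdiff_disjoint)
          rw [this]; simp)
    refine le_trans ?_ h
    gcongr
    intro y hy
    obtain ⟨h1, h2⟩ := hE y hy
    simp only [mem_filter, mem_univ, true_and]
    intro i hi hs
    refine h2 i hi fun p hp => ?_
    by_cases hpK : p ∈ K
    · exact h1 p hpK
    · exact hs p (mem_sdiff.2 ⟨hp, hpK⟩)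
  have hPS : P ⊆ S := filter_subset _ _
  refine ⟨i0, hi0'.1, K, hi0'.2, I, P \ I, hIP.trans hPS, sdiff_subset.trans hPS,
    disjoint_sdiff, key I hIP (by omega), key _ sdiff_subset ?_⟩
  rw [card_sdiff_of_subset hIP]
  omega

/-- The literals read by the tree on input `y`. -/
def DTree.path {m : ℕ} : DTree m → (Fin m → Bool) → Finset (Fin m × Bool)
  | .leaf _, _ => ∅
  | .node i t0 t1, y => insert (i, y i) (if y i then t1.path y else t0.path y)

lemma sat_insert {m : ℕ} (y : Fin m → Bool) (p : Fin m × Bool) (T : Finset (Fin m × Bool)) :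
    Sat y (insert p T) ↔ y p.1 = p.2 ∧ Sat y T := by
  unfold Sat
  simp only [Finset.mem_insert, forall_eq_or_imp]

lemma DTree.sat_path {m : ℕ} (t : DTree m) (y : Fin m → Bool) : Sat y (t.path y) := by
  induction t with
  | leaf b => intro p hp; simp [DTree.path] at hp
  | node i t0 t1 h0 h1 =>
    rw [DTree.path, sat_insert]
    refine ⟨rfl, ?_⟩
    split_ifs
    exacts [h1, h0]

lemma DTree.eval_of_sat {m : ℕ} (t : DTree m) (y y' : Fin m → Bool) (h : Sat y' (t.path y)) :
    t.eval y' = t.eval y := by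
  induction t with
  | leaf b => rfl
  | node i t0 t1 h0 h1 =>
    rw [DTree.path, sat_insert] at h
    obtain ⟨h2, h⟩ := h
    simp only at h2
    rw [DTree.eval, DTree.eval, h2]
    split_ifs at h ⊢
    exacts [h1 h, h0 h]

lemma DTree.card_path {m : ℕ} (t : DTree m) (y : Fin m → Bool) : (t.path y).card ≤ t.depth := by
  induction t with
  | leaf b => simp [DTree.path]
  | node i t0 t1 h0 h1 =>
    rw [DTree.path, DTree.depth]
    refine (card_insert_le _ _).trans ?_
    split_ifs <;> omega

lemma DTree.card_image_path {m : ℕ} (t : DTree m) :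
    (univ.image t.path).card ≤ 2 ^ t.depth := by
  induction t with
  | leaf b =>
    rw [DTree.depth, pow_zero, card_le_one]
    intro a ha b hb
    simp [DTree.path] at ha hb
    rw [← ha, ← hb]
  | node i t0 t1 h0 h1 =>
    have hsub : univ.image (DTree.node i t0 t1).path ⊆
        ((univ.image t0.path).image (insert (i, false))) ∪
        ((univ.image t1.path).image (insert (i, true))) := by
      intro P hP
      obtain ⟨y, -, rfl⟩ := mem_image.1 hP
      rw [DTree.path, mem_union]
      cases hy : y i
      · left
        simp
      · right
        simp
    refine (card_le_card hsub).trans ((card_union_le _ _).trans ?_)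
    have e0 := (card_image_le (s := univ.image t0.path) (f := insert (i, false))).trans h0
    have e1 := (card_image_le (s := univ.image t1.path) (f := insert (i, true))).trans h1
    rw [DTree.depth, pow_succ]
    have := Nat.pow_le_pow_right (n := 2) (by norm_num) (le_max_left t0.depth t1.depth)
    have := Nat.pow_le_pow_right (n := 2) (by norm_num) (le_max_right t0.depth t1.depth)
    omega

/-- unit strings -/
def unitStr {n : ℕ} (i : Fin n) : Fin n → Bool := fun j => decide (j = i)

lemma wt_unitStr {n : ℕ} (i : Fin n) : wt (unitStr i) = 1 := by
  simp [wt, unitStr, Finset.filter_eq']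

lemma unitStr_inj {n : ℕ} : Function.Injective (unitStr (n := n)) := by
  intro i j h
  have := congrFun h i
  simpa [unitStr] using this

lemma core_s2 {n m d r : ℕ} (hr : 0 < r) (f : (Fin m → Bool) → (Fin n → Bool))
    (hf : hasDecisionDepth f d) :
    ∃ S : Finset (Fin n), S.card ≤ (24 * (d + 1) * r) ^ d ∧
      ((univ.filter fun y => f y ∈ Sᶜ.image unitStr).card : ℝ) * 4 ^ r
        ≤ n * 2 ^ d * (2 * 2 ^ m) := by
  classical
  choose t ht hft using hf
  set Ev : Finset (Fin m × Bool) → Finset (Fin m → Bool) := fun K =>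
    univ.filter fun y => Sat y K ∧ wt (f y) ≤ 1 with hEv
  set good : Finset (Fin m × Bool) → Prop := fun K => ((Ev K).card : ℝ) * 4 ^ r ≤ 2 * 2 ^ m
    with hgood
  set S : Finset (Fin n) := univ.filter fun i =>
    ∃ y, f y i = true ∧ ∀ K ⊆ (t i).path y, ¬ good K with hSdef
  refine ⟨S, ?_, ?_⟩
  · by_contra hlt
    push Not at hlt
    have hex : ∀ i, i ∈ S → ∃ y, f y i = true ∧ ∀ K ⊆ (t i).path y, ¬ good K := by
      intro i hi
      simpa [hSdef] using hi
    choose! y hy1 hy2 using hex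
    obtain ⟨i0, hi0, K, hK, I, J, hI, hJ, hIJ, h1, h2⟩ := robust hr S (fun i => (t i).path (y i))
      (fun i _ => ⟨y i, DTree.sat_path _ _⟩)
      (fun i _ => (DTree.card_path _ _).trans (ht i)) hlt
    refine hy2 i0 hi0 K hK ?_
    have h1' := h1 ((Ev K).filter fun z => ∀ i ∈ I, ¬ Sat z ((t i).path (y i))) (by
      intro z hz
      simp only [hEv, mem_filter, mem_univ, true_and] at hz
      exact ⟨hz.1.1, hz.2⟩)
    have h2' := h2 ((Ev K).filter fun z => ∀ i ∈ J, ¬ Sat z ((t i).path (y i))) (by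
      intro z hz
      simp only [hEv, mem_filter, mem_univ, true_and] at hz
      exact ⟨hz.1.1, hz.2⟩)
    have hsub : Ev K ⊆ ((Ev K).filter fun z => ∀ i ∈ I, ¬ Sat z ((t i).path (y i))) ∪
        ((Ev K).filter fun z => ∀ i ∈ J, ¬ Sat z ((t i).path (y i))) := by
      intro z hz
      by_contra hno
      simp only [mem_union, mem_filter, hz, true_and, not_or, not_forall, not_not] at hno
      obtain ⟨⟨i, hi, hsi⟩, ⟨j, hj, hsj⟩⟩ := hno
      have hij : i ≠ j := fun h => (disjoint_left.1 hIJ hi) (h ▸ hj)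
      have hfi : f z i = true := by
        rw [hft, DTree.eval_of_sat _ _ _ hsi, ← hft]; exact hy1 i (hI hi)
      have hfj : f z j = true := by
        rw [hft, DTree.eval_of_sat _ _ _ hsj, ← hft]; exact hy1 j (hJ hj)
      have hw : wt (f z) ≤ 1 := (mem_filter.1 hz).2.2
      have : 1 < wt (f z) := by
        rw [wt, one_lt_card]
        exact ⟨i, by simp [hfi], j, by simp [hfj], hij⟩
      omega
    have hc : ((Ev K).card : ℝ) ≤
        (((Ev K).filter fun z => ∀ i ∈ I, ¬ Sat z ((t i).path (y i))).card : ℝ) +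
        (((Ev K).filter fun z => ∀ i ∈ J, ¬ Sat z ((t i).path (y i))).card : ℝ) := by
      exact_mod_cast (card_le_card hsub).trans (card_union_le _ _)
    have h4 : (0:ℝ) < 4 ^ r := by positivity
    show ((Ev K).card : ℝ) * 4 ^ r ≤ 2 * 2 ^ m
    nlinarith
  · set Pth : Fin n → Finset (Finset (Fin m × Bool)) := fun i =>
      (univ.filter fun y => f y i = true).image (t i).path with hPth
    have hsub : (univ.filter fun y => f y ∈ Sᶜ.image unitStr) ⊆
        Sᶜ.biUnion fun i => (Pth i).biUnion Ev := by
      intro y hy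
      simp only [mem_filter, mem_univ, true_and, mem_image] at hy
      obtain ⟨i, hi, hiy⟩ := hy
      rw [mem_biUnion]
      refine ⟨i, hi, ?_⟩
      rw [mem_biUnion]
      refine ⟨(t i).path y, mem_image_of_mem _ ?_, ?_⟩
      · simp [← hiy, unitStr]
      · simp only [hEv, mem_filter, mem_univ, true_and]
        exact ⟨DTree.sat_path _ _, by rw [← hiy, wt_unitStr]⟩
    have hc1 : ((univ.filter fun y => f y ∈ Sᶜ.image unitStr).card : ℝ) ≤
        ∑ i ∈ Sᶜ, ∑ P ∈ Pth i, ((Ev P).card : ℝ) := by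
      have := (card_le_card hsub).trans (card_biUnion_le.trans
        (sum_le_sum fun i _ => card_biUnion_le))
      exact_mod_cast this
    have hP : ∀ i ∈ Sᶜ, ∀ P ∈ Pth i, ((Ev P).card : ℝ) * 4 ^ r ≤ 2 * 2 ^ m := by
      intro i hi P hP
      obtain ⟨y, hy, rfl⟩ := mem_image.1 hP
      have hy' : f y i = true := (mem_filter.1 hy).2
      have : ∃ K ⊆ (t i).path y, good K := by
        by_contra hno
        push Not at hno
        rw [mem_compl] at hi
        exact hi (mem_filter.2 ⟨mem_univ _, y, hy', hno⟩)
      obtain ⟨K, hK, hg⟩ := this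
      refine le_trans ?_ hg
      gcongr
      intro z hz
      simp only [hEv, mem_filter, mem_univ, true_and] at hz ⊢
      exact ⟨fun p hp => hz.1 p (hK hp), hz.2⟩
    calc _ ≤ (∑ i ∈ Sᶜ, ∑ P ∈ Pth i, ((Ev P).card : ℝ)) * 4 ^ r := by gcongr
      _ = ∑ i ∈ Sᶜ, ∑ P ∈ Pth i, ((Ev P).card : ℝ) * 4 ^ r := by
          rw [sum_mul]; simp_rw [sum_mul]
      _ ≤ ∑ i ∈ Sᶜ, ∑ P ∈ Pth i, ((2:ℝ) * 2 ^ m) :=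
          sum_le_sum fun i hi => sum_le_sum fun P hPP => hP i hi P hPP
      _ ≤ ∑ i ∈ Sᶜ, (2:ℝ) ^ d * (2 * 2 ^ m) := by
          apply sum_le_sum
          intro i _
          rw [sum_const, nsmul_eq_mul]
          gcongr
          have h1 : (Pth i).card ≤ 2 ^ d :=
            (card_le_card (image_subset_image (subset_univ _))).trans
              ((DTree.card_image_path (t i)).trans (Nat.pow_le_pow_right (by norm_num) (ht i)))
          exact_mod_cast h1
      _ ≤ _ := by
          rw [sum_const, nsmul_eq_mul, mul_assoc]
          gcongr
          exact (card_le_univ _).trans (by simp)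

lemma SD_ge {n m : ℕ} (hn : 0 < n) (f : (Fin m → Bool) → (Fin n → Bool)) (S : Finset (Fin n)) :
    1 - (S.card : ℝ) / n -
      ((univ.filter fun y => f y ∈ Sᶜ.image unitStr).card : ℝ) / 2 ^ m
      ≤ SD (srcDist f) (uniformSlice n 1) := by
  have hn' : (n : ℝ) ≠ 0 := by exact_mod_cast hn.ne'
  have h1 : ∑ x ∈ Sᶜ.image unitStr, srcDist f x
      = ((univ.filter fun y => f y ∈ Sᶜ.image unitStr).card : ℝ) / 2 ^ m := by
    simp only [srcDist]
    rw [← sum_div]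
    congr 1
    rw [card_eq_sum_card_fiberwise (f := f) (t := Sᶜ.image unitStr) (by
      intro y hy; simpa using hy)]
    push_cast
    apply sum_congr rfl
    intro x hx
    congr 2
    ext y
    simp only [mem_filter, mem_univ, true_and]
    constructor
    · intro h; exact ⟨h ▸ hx, h⟩
    · exact fun h => h.2
  have h2 : ∑ x ∈ Sᶜ.image unitStr, uniformSlice n 1 x = 1 - (S.card : ℝ) / n := by
    rw [sum_image (fun a _ b _ h => unitStr_inj h)]
    simp only [uniformSlice, wt_unitStr, if_true, Nat.choose_one_right]
    rw [sum_const, card_compl, nsmul_eq_mul, Fintype.card_fin,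
      Nat.cast_sub (by simpa using card_le_univ S)]
    field_simp
  have h3 := le_ciSup (f := fun A : Finset (Fin n → Bool) =>
    |∑ x ∈ A, srcDist f x - ∑ x ∈ A, uniformSlice n 1 x|) (Set.finite_range _).bddAbove
    (Sᶜ.image unitStr)
  refine le_trans ?_ h3
  rw [h1, h2, abs_sub_comm]
  exact le_abs_self _

/-- There are constants `τ, c > 0` such that for all sufficiently large `n`,
every distribution on `{0,1}^n` sampled with decision depth at most `τ log n / log log n`
is `(1 - n^{-c})`-far from `U_1^n`. -/
theorem stmt2 :
    ∃ τ c : ℝ, 0 < τ ∧ 0 < c ∧ ∃ N : ℕ, ∀ n : ℕ, N ≤ n →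
      ∀ (m d : ℕ) (f : (Fin m → Bool) → (Fin n → Bool)),
        hasDecisionDepth f d →
        (d : ℝ) ≤ τ * Real.log n / Real.log (Real.log n) →
        1 - (n : ℝ) ^ (-c) ≤ SD (srcDist f) (uniformSlice n 1) := by

  refine ⟨1 / 6, 1 / 4, by norm_num, by norm_num, ⌈Real.exp 96⌉₊, ?_⟩
  intro n hn m d f hf hd
  have hnexp : Real.exp 96 ≤ n := (Nat.le_ceil _).trans (by exact_mod_cast hn)
  have hnpos : (0:ℝ) < n := lt_of_lt_of_le (Real.exp_pos _) hnexp
  have hn0 : 0 < n := by exact_mod_cast hnpos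
  set L := Real.log n with hL
  have hexpL : Real.exp L = n := Real.exp_log hnpos
  have hL96 : 96 ≤ L := (Real.le_log_iff_exp_le hnpos).2 hnexp
  have hLL : 1 ≤ Real.log L := by
    rw [Real.le_log_iff_exp_le (by linarith)]
    have := Real.exp_one_lt_d9
    linarith
  have hdL : (d : ℝ) * Real.log L ≤ L / 6 := by
    rw [le_div_iff₀ (by linarith)] at hd
    linarith
  have hd0 : (0:ℝ) ≤ d := by positivity
  have hdL' : (d : ℝ) ≤ L / 6 := by nlinarith
  set r := ⌈3 * L⌉₊ with hr
  have hr1 : 3 * L ≤ r := Nat.le_ceil _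
  have hr2 : (r : ℝ) ≤ 4 * L := by
    have := Nat.ceil_lt_add_one (a := 3 * L) (by linarith)
    rw [← hr] at this
    linarith
  have hrpos : 0 < r := by
    have : (0:ℝ) < r := by linarith
    exact_mod_cast this
  obtain ⟨S, hS1, hS2⟩ := core_s2 hrpos f hf
  refine le_trans ?_ (SD_ge hn0 f S)
  -- size of S
  have hS : (S.card : ℝ) ≤ Real.exp (L / 2) := by
    have h1 : (S.card : ℝ) ≤ (24 * (d + 1) * r) ^ d := by exact_mod_cast hS1
    have h2 : (24 * ((d:ℝ) + 1) * r) ≤ L ^ 3 := by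
      have : ((d:ℝ) + 1) * r ≤ L * (4 * L) := by
        apply mul_le_mul (by linarith) hr2 (by positivity) (by linarith)
      nlinarith [mul_le_mul_of_nonneg_right hL96 (sq_nonneg L)]
    calc (S.card : ℝ) ≤ (24 * ((d:ℝ) + 1) * r) ^ d := h1
      _ ≤ (L ^ 3) ^ d := by gcongr
      _ = Real.exp (3 * (d * Real.log L)) := by
          rw [← pow_mul, ← Real.exp_log (show 0 < L by linarith), ← Real.exp_nat_mul, Real.log_exp]
          push_cast
          ring_nf
      _ ≤ _ := by
          apply Real.exp_le_exp.2
          linarith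
  -- the bad event
  have h2d : (2:ℝ) ^ d ≤ n := by
    calc (2:ℝ) ^ d ≤ (Real.exp 1) ^ d := by
          gcongr
          have := Real.add_one_le_exp 1
          linarith
      _ = Real.exp d := by rw [← Real.exp_nat_mul, mul_one]
      _ ≤ n := by rw [← hexpL]; apply Real.exp_le_exp.2; linarith
  have h4r : (n:ℝ) ^ 3 ≤ 4 ^ r := by
    calc (n:ℝ) ^ 3 = Real.exp (3 * L) := by
          rw [← hexpL, ← Real.exp_nat_mul]; norm_num
      _ ≤ Real.exp r := Real.exp_le_exp.2 hr1
      _ = (Real.exp 1) ^ r := by rw [← Real.exp_nat_mul, mul_one]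
      _ ≤ 4 ^ r := by
          gcongr
          have := Real.exp_one_lt_d9
          linarith
  have hbad : ((univ.filter fun y => f y ∈ Sᶜ.image unitStr).card : ℝ) / 2 ^ m ≤ 2 / n := by
    rw [div_le_div_iff₀ (by positivity) hnpos]
    set B := ((univ.filter fun y => f y ∈ Sᶜ.image unitStr).card : ℝ)
    have hB : 0 ≤ B := by positivity
    have h5 : B * (n:ℝ) ^ 3 ≤ (n * n) * (2 * 2 ^ m) := by
      calc _ ≤ B * 4 ^ r := by gcongr
        _ ≤ n * 2 ^ d * (2 * 2 ^ m) := hS2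
        _ ≤ _ := by gcongr
    have h6 : (0:ℝ) < n * n := by positivity
    refine le_of_mul_le_mul_left ?_ h6
    calc _ = B * (n:ℝ) ^ 3 := by ring
      _ ≤ _ := h5
  set u := Real.exp (-(L / 4)) with hu
  have hu0 : 0 < u := Real.exp_pos _
  have hu1 : u ≤ 1 / 2 := by
    rw [hu, Real.exp_neg, ← one_div]
    apply one_div_le_one_div_of_le (by norm_num)
    have := Real.add_one_le_exp (L / 4)
    linarith
  have hpow : (n:ℝ) ^ (-(1 / 4 : ℝ)) = u := by
    rw [Real.rpow_def_of_pos hnpos, hu]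
    congr 1
    ring
  have hSn : (S.card : ℝ) / n ≤ u ^ 2 := by
    rw [div_le_iff₀ hnpos, ← hexpL, hu, ← Real.exp_nat_mul, ← Real.exp_add]
    refine hS.trans (le_of_eq ?_)
    congr 1
    push_cast
    ring
  have h2n : 2 / (n:ℝ) = 2 * u ^ 4 := by
    rw [hu, ← Real.exp_nat_mul, ← hexpL, div_eq_mul_inv, ← Real.exp_neg]
    congr 2
    push_cast
    ring
  rw [hpow]
  rw [h2n] at hbad
  have hu2 : u ^ 2 ≤ u / 2 := by nlinarith
  have hu4 : u ^ 4 ≤ u / 8 := by nlinarith [sq_nonneg (u ^ 2)]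
  linarith
end
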